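/- The divisor class of (2, 17) + (4, 23) − P₁ − P₂, where P₁ and P₂ are the two points at infinity, is a torsion point of order exactly 70 on the Jacobian of the genus-2 curve C₇₀ : y² + (2x³ − 3x² − 41x + 110)y = x³ − 51x² + 425x + 179 over ℚ. -/

import Mathlib

open scoped Classical

/-- A *place* of a function field `F` over `ℚ`: a nontrivial valuation subring of `F`
containing `ℚ`.  For the function field of a smooth projective curve over `ℚ`, these are
exactly the closed points of the curve. -/
def IsCurvePlace {F : Type*} [Field F] [Algebra ℚ F] (v : ValuationSubring F) : Prop :=
  v ≠ ⊤ ∧ ∀ a : ℚ, algebraMap ℚ F a ∈ v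


namespace C70

set_option linter.unusedSectionVars false

/-- `o` is the normalized valuation attached to the valuation ring `v`. -/
structure OrdAt {F : Type*} [Field F] [Algebra ℚ F] (v : ValuationSubring F) (o : F → ℤ) :
    Prop where
  rat : ∀ a : ℚ, (a : F) ∈ v
  mul : ∀ f g : F, f ≠ 0 → g ≠ 0 → o (f * g) = o f + o g
  unif : ∃ f : F, f ≠ 0 ∧ o f = 1
  ring : ∀ f : F, f ≠ 0 → (0 ≤ o f ↔ f ∈ v)

section basics

variable {F : Type*} [Field F] [Algebra ℚ F] {v : ValuationSubring F} {o : F → ℤ}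

theorem OrdAt.one (h : OrdAt v o) : o 1 = 0 := by
  have := h.mul 1 1 one_ne_zero one_ne_zero
  rw [mul_one] at this
  omega

theorem OrdAt.inv (h : OrdAt v o) {f : F} (hf : f ≠ 0) : o f⁻¹ = - o f := by
  have := h.mul f f⁻¹ hf (inv_ne_zero hf)
  rw [mul_inv_cancel₀ hf, h.one] at this
  omega

theorem OrdAt.pow (h : OrdAt v o) {f : F} (hf : f ≠ 0) (n : ℕ) : o (f ^ n) = n * o f := by
  induction n with
  | zero => simp [h.one]
  | succ k ih =>
    rw [pow_succ, h.mul _ _ (pow_ne_zero _ hf) hf, ih]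
    push_cast
    ring

theorem OrdAt.zpow (h : OrdAt v o) {f : F} (hf : f ≠ 0) (n : ℤ) : o (f ^ n) = n * o f := by
  cases n with
  | ofNat n => simpa using h.pow hf n
  | negSucc n =>
    rw [zpow_negSucc, h.inv (pow_ne_zero _ hf), h.pow hf, Int.negSucc_eq]
    push_cast
    ring

theorem OrdAt.nonneg_iff (h : OrdAt v o) {f : F} (hf : f ≠ 0) :
    0 ≤ o f ↔ v.valuation f ≤ 1 := by
  rw [h.ring f hf, v.valuation_le_one_iff]

theorem OrdAt.nonpos_iff (h : OrdAt v o) {f : F} (hf : f ≠ 0) :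
    o f ≤ 0 ↔ 1 ≤ v.valuation f := by
  have := h.nonneg_iff (inv_ne_zero hf)
  rw [h.inv hf, map_inv₀, inv_le_one₀ (by simpa [zero_lt_iff] using hf)] at this
  rw [← this]
  omega

theorem OrdAt.pos_iff (h : OrdAt v o) {f : F} (hf : f ≠ 0) :
    0 < o f ↔ v.valuation f < 1 := by
  rw [← not_le, h.nonpos_iff hf, not_le]

theorem OrdAt.zero_iff (h : OrdAt v o) {f : F} (hf : f ≠ 0) :
    o f = 0 ↔ v.valuation f = 1 := by
  rw [le_antisymm_iff, le_antisymm_iff, h.nonneg_iff hf, h.nonpos_iff hf, and_comm]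

theorem OrdAt.val_rat (h : OrdAt v o) (c : ℚ) : v.valuation (c : F) ≤ 1 :=
  (v.valuation_le_one_iff _).2 (h.rat c)

theorem OrdAt.val_rat_eq (h : OrdAt v o) {c : ℚ} (hc : c ≠ 0) : v.valuation (c : F) = 1 := by
  apply le_antisymm (h.val_rat c)
  have h1 := h.val_rat c⁻¹
  have : CharZero F := algebraRat.charZero F
  rwa [Rat.cast_inv, map_inv₀, inv_le_one₀ (by simpa [zero_lt_iff] using hc)] at h1

/-- `f` has value `c` at the place `v`. -/
def Res (v : ValuationSubring F) (f : F) (c : ℚ) : Prop := v.valuation (f - (c : F)) < 1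

theorem Res.le (h : OrdAt v o) {f : F} {c : ℚ} (hf : Res v f c) : v.valuation f ≤ 1 := by
  have : f = (f - c) + c := by ring
  rw [this]
  exact v.valuation.map_add_le (le_of_lt hf) (h.val_rat c)

theorem Res.const (c : ℚ) : Res v (c : F) c := by
  simp [Res]

theorem Res.add {f g : F} {c d : ℚ} (hf : Res v f c) (hg : Res v g d) :
    Res v (f + g) (c + d) := by
  have : CharZero F := algebraRat.charZero F
  have e : f + g - ((c + d : ℚ) : F) = (f - c) + (g - d) := by push_cast; ring
  unfold Res
  rw [e]
  exact v.valuation.map_add_lt hf hg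

theorem Res.neg {f : F} {c : ℚ} (hf : Res v f c) : Res v (-f) (-c) := by
  have e : -f - ((-c : ℚ) : F) = -(f - c) := by push_cast; ring
  unfold Res
  rw [e, Valuation.map_neg]
  exact hf

theorem Res.sub {f g : F} {c d : ℚ} (hf : Res v f c) (hg : Res v g d) :
    Res v (f - g) (c - d) := by
  rw [sub_eq_add_neg, sub_eq_add_neg]
  exact hf.add hg.neg

theorem mul_lt_of_le {f g : F} (hf : v.valuation f ≤ 1) (hg : v.valuation g < 1) :
    v.valuation (f * g) < 1 := by
  rw [map_mul]
  exact (mul_le_of_le_one_left' hf).trans_lt hg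

theorem Res.mul (h : OrdAt v o) {f g : F} {c d : ℚ} (hf : Res v f c) (hg : Res v g d) :
    Res v (f * g) (c * d) := by
  have : CharZero F := algebraRat.charZero F
  have e : f * g - ((c * d : ℚ) : F) = f * (g - d) + d * (f - c) := by push_cast; ring
  unfold Res
  rw [e]
  exact v.valuation.map_add_lt (mul_lt_of_le (hf.le h) hg) (mul_lt_of_le (h.val_rat d) hf)

theorem Res.pow (h : OrdAt v o) {f : F} {c : ℚ} (hf : Res v f c) (n : ℕ) :
    Res v (f ^ n) (c ^ n) := by
  induction n with
  | zero => simpa using Res.const (v := v) 1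
  | succ k ih => rw [pow_succ, pow_succ]; exact ih.mul h hf

theorem Res.val_eq (h : OrdAt v o) {f : F} {c : ℚ} (hf : Res v f c) (hc : c ≠ 0) :
    v.valuation f = 1 := by
  have : f = (f - c) + c := by ring
  rw [this, Valuation.map_add_eq_of_lt_right, h.val_rat_eq hc]
  rw [h.val_rat_eq hc]
  exact hf

theorem Res.ne (h : OrdAt v o) {f : F} {c : ℚ} (hf : Res v f c) (hc : c ≠ 0) : f ≠ 0 := by
  rintro rfl
  simpa using hf.val_eq h hc

theorem Res.ord (h : OrdAt v o) {f : F} {c : ℚ} (hf : Res v f c) (hc : c ≠ 0) : o f = 0 :=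
  (h.zero_iff (hf.ne h hc)).2 (hf.val_eq h hc)

theorem Res.lt {f : F} (hf : Res v f 0) : v.valuation f < 1 := by
  simpa [Res] using hf

theorem Res.ord_pos (h : OrdAt v o) {f : F} (hf : Res v f 0) (h0 : f ≠ 0) : 0 < o f :=
  (h.pos_iff h0).2 hf.lt

theorem Res.ord_nonneg (h : OrdAt v o) {f : F} {c : ℚ} (hf : Res v f c) (h0 : f ≠ 0) :
    0 ≤ o f :=
  (h.nonneg_iff h0).2 (hf.le h)

theorem Res.uniq (h : OrdAt v o) {f : F} {c d : ℚ} (hf : Res v f c) (hg : Res v f d) :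
    c = d := by
  by_contra hne
  have := hf.sub hg
  rw [sub_self] at this
  exact this.ne h (sub_ne_zero.2 hne) rfl

theorem Res.congr {f g : F} {c d : ℚ} (hf : Res v f c) (hfg : f = g) (hcd : c = d) :
    Res v g d := by
  subst hfg hcd
  exact hf

theorem decomp {s t f : F} (hf : f ∈ Algebra.adjoin ℚ ({s, t} : Set F)) :
    ∃ c : ℚ, ∃ a ∈ Algebra.adjoin ℚ ({s, t} : Set F), ∃ b ∈ Algebra.adjoin ℚ ({s, t} : Set F),
      f = c + a * s + b * t := by
  have hs : s ∈ Algebra.adjoin ℚ ({s, t} : Set F) := Algebra.subset_adjoin (by simp)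
  have ht : t ∈ Algebra.adjoin ℚ ({s, t} : Set F) := Algebra.subset_adjoin (by simp)
  have hq : ∀ c : ℚ, (c : F) ∈ Algebra.adjoin ℚ ({s, t} : Set F) := fun c => by
    simpa using Subalgebra.algebraMap_mem (Algebra.adjoin ℚ ({s, t} : Set F)) c
  have : CharZero F := algebraRat.charZero F
  induction hf using Algebra.adjoin_induction with
  | mem z hz =>
    rcases hz with rfl | hz
    · exact ⟨0, 1, one_mem _, 0, zero_mem _, by simp⟩
    · rw [Set.mem_singleton_iff] at hz
      subst hz
      exact ⟨0, 0, zero_mem _, 1, one_mem _, by simp⟩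
  | algebraMap r => exact ⟨r, 0, zero_mem _, 0, zero_mem _, by simp⟩
  | add f g _ _ ihf ihg =>
    obtain ⟨c, a, ha, b, hb, rfl⟩ := ihf
    obtain ⟨c', a', ha', b', hb', rfl⟩ := ihg
    exact ⟨c + c', a + a', add_mem ha ha', b + b', add_mem hb hb', by push_cast; ring⟩
  | mul f g hf hg ihf ihg =>
    obtain ⟨c, a, ha, b, hb, rfl⟩ := ihf
    obtain ⟨c', a', ha', b', hb', rfl⟩ := ihg
    refine ⟨c * c', c * a' + a * (c' + a' * s + b' * t),
      add_mem (mul_mem (hq _) ha') (mul_mem ha hg),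
      c * b' + b * (c' + a' * s + b' * t),
      add_mem (mul_mem (hq _) hb') (mul_mem hb hg), by push_cast; ring⟩

theorem adjoin_le {s t f : F} (h : OrdAt v o) (hs : v.valuation s < 1) (ht : v.valuation t < 1)
    (hf : f ∈ Algebra.adjoin ℚ ({s, t} : Set F)) : v.valuation f ≤ 1 := by
  induction hf using Algebra.adjoin_induction with
  | mem z hz =>
    rcases hz with rfl | hz
    · exact hs.le
    · rw [Set.mem_singleton_iff] at hz
      subst hz
      exact ht.le
  | algebraMap r => simpa using h.val_rat r
  | add f g _ _ ihf ihg => exact v.valuation.map_add_le ihf ihg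
  | mul f g hf hg ihf ihg => rw [map_mul]; exact mul_le_one' ihf ihg

/-- Smooth points: every polynomial function is a power of the uniformizer times a unit. -/
theorem key_poly {w : ValuationSubring F} {o' : F → ℤ} {s t q r : F}
    (hv : OrdAt v o) (hw : OrdAt w o')
    (hsv : v.valuation s < 1) (htv : v.valuation t < 1)
    (hsw : w.valuation s < 1) (htw : w.valuation t < 1) (ht0 : t ≠ 0)
    (hq : q ∈ Algebra.adjoin ℚ ({s, t} : Set F)) (hr : r ∈ Algebra.adjoin ℚ ({s, t} : Set F))
    (hqr : s * q = t * r) (hqv : v.valuation q = 1) (hqw : w.valuation q = 1) :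
    ∀ (n : ℕ) (f : F), f ∈ Algebra.adjoin ℚ ({s, t} : Set F) → f ≠ 0 → o f ≤ n →
      ∃ (k : ℤ) (e : F), f = t ^ k * e ∧ v.valuation e = 1 ∧ w.valuation e = 1 := by
  have hotv : 0 < o t := (hv.pos_iff ht0).2 htv
  have hq0 : q ≠ 0 := by
    rintro rfl
    simp at hqv
  have hoq : o q = 0 := (hv.zero_iff hq0).2 hqv
  intro n
  induction n with
  | zero =>
    intro f hf hf0 hfo
    obtain ⟨c, a, ha, b, hb, rfl⟩ := decomp hf
    have rv : Res v ((c : F) + a * s + b * t) c := by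
      have e : (c : F) + a * s + b * t - c = a * s + b * t := by ring
      unfold Res
      rw [e]
      exact v.valuation.map_add_lt (mul_lt_of_le (adjoin_le hv hsv htv ha) hsv)
        (mul_lt_of_le (adjoin_le hv hsv htv hb) htv)
    have rw' : Res w ((c : F) + a * s + b * t) c := by
      have e : (c : F) + a * s + b * t - c = a * s + b * t := by ring
      unfold Res
      rw [e]
      exact w.valuation.map_add_lt (mul_lt_of_le (adjoin_le hw hsw htw ha) hsw)
        (mul_lt_of_le (adjoin_le hw hsw htw hb) htw)
    by_cases hc : c = 0
    · subst hc
      have := rv.ord_pos hv hf0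
      rw [Nat.cast_zero] at hfo
      exact absurd this (not_lt.2 hfo)
    · exact ⟨0, _, by simp, rv.val_eq hv hc, rw'.val_eq hw hc⟩
  | succ n ih =>
    intro f hf hf0 hfo
    obtain ⟨c, a, ha, b, hb, rfl⟩ := decomp hf
    have rv : Res v ((c : F) + a * s + b * t) c := by
      have e : (c : F) + a * s + b * t - c = a * s + b * t := by ring
      unfold Res
      rw [e]
      exact v.valuation.map_add_lt (mul_lt_of_le (adjoin_le hv hsv htv ha) hsv)
        (mul_lt_of_le (adjoin_le hv hsv htv hb) htv)
    have rw' : Res w ((c : F) + a * s + b * t) c := by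
      have e : (c : F) + a * s + b * t - c = a * s + b * t := by ring
      unfold Res
      rw [e]
      exact w.valuation.map_add_lt (mul_lt_of_le (adjoin_le hw hsw htw ha) hsw)
        (mul_lt_of_le (adjoin_le hw hsw htw hb) htw)
    by_cases hc : c = 0
    · subst hc
      have e : q * (((0 : ℚ) : F) + a * s + b * t) = t * (a * r + b * q) := by
        push_cast
        linear_combination a * hqr
      have h1 : a * r + b * q ≠ 0 := by
        intro h1
        rw [h1, mul_zero] at e
        exact (mul_ne_zero hq0 hf0) e
      have h2 : o (a * r + b * q) ≤ n := by
        have e2 := congrArg o e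
        rw [hv.mul _ _ hq0 hf0, hv.mul _ _ ht0 h1, hoq] at e2
        push_cast at hfo e2
        omega
      obtain ⟨k, e', he, hev, hew⟩ := ih _ (add_mem (mul_mem ha hr) (mul_mem hb hq)) h1 h2
      refine ⟨k + 1, e' * q⁻¹, ?_, by simp [hev, hqv], by simp [hew, hqw]⟩
      rw [zpow_add_one₀ ht0]
      rw [he] at e
      field_simp
      linear_combination e
    · exact ⟨0, _, by simp, rv.val_eq hv hc, rw'.val_eq hw hc⟩

/-- Uniqueness of the place centered at a smooth point, and its uniformizer. -/
theorem key {w : ValuationSubring F} {o' : F → ℤ} {s t q r : F}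
    (hv : OrdAt v o) (hw : OrdAt w o')
    (hgen : IntermediateField.adjoin ℚ ({s, t} : Set F) = ⊤)
    (hsv : v.valuation s < 1) (htv : v.valuation t < 1)
    (hsw : w.valuation s < 1) (htw : w.valuation t < 1) (ht0 : t ≠ 0)
    (hq : q ∈ Algebra.adjoin ℚ ({s, t} : Set F)) (hr : r ∈ Algebra.adjoin ℚ ({s, t} : Set F))
    (hqr : s * q = t * r) (hqv : v.valuation q = 1) (hqw : w.valuation q = 1) :
    v = w ∧ o t = 1 := by
  have hotv : 0 < o t := (hv.pos_iff ht0).2 htv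
  have hotw : 0 < o' t := (hw.pos_iff ht0).2 htw
  have main : ∀ f : F, f ≠ 0 →
      ∃ (k : ℤ) (e : F), f = t ^ k * e ∧ v.valuation e = 1 ∧ w.valuation e = 1 := by
    intro f hf
    have hmem : f ∈ IntermediateField.adjoin ℚ ({s, t} : Set F) := by rw [hgen]; trivial
    rw [IntermediateField.mem_adjoin_iff_div] at hmem
    obtain ⟨a, ha, b, hb, rfl⟩ := hmem
    have ha0 : a ≠ 0 := by rintro rfl; simp at hf
    have hb0 : b ≠ 0 := by rintro rfl; simp at hf
    obtain ⟨k, e, he, h1, h2⟩ := key_poly hv hw hsv htv hsw htw ht0 hq hr hqr hqv hqw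
      (o a).toNat a ha ha0 (Int.self_le_toNat _)
    obtain ⟨k', e', he', h1', h2'⟩ := key_poly hv hw hsv htv hsw htw ht0 hq hr hqr hqv hqw
      (o b).toNat b hb hb0 (Int.self_le_toNat _)
    refine ⟨k - k', e / e', ?_, by simp [h1, h1'], by simp [h2, h2']⟩
    rw [zpow_sub₀ ht0, he, he', mul_div_mul_comm]
  have main2 : ∀ f : F, f ≠ 0 → ∃ k : ℤ, o f = k * o t ∧ o' f = k * o' t := by
    intro f hf
    obtain ⟨k, e, he, h1, h2⟩ := main f hf
    have he0 : e ≠ 0 := by rintro rfl; simp at h1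
    refine ⟨k, ?_, ?_⟩
    · rw [he, hv.mul _ _ (zpow_ne_zero _ ht0) he0, hv.zpow ht0, (hv.zero_iff he0).2 h1, add_zero]
    · rw [he, hw.mul _ _ (zpow_ne_zero _ ht0) he0, hw.zpow ht0, (hw.zero_iff he0).2 h2, add_zero]
  constructor
  · ext f
    by_cases hf : f = 0
    · subst hf
      simp
    · obtain ⟨k, h1, h2⟩ := main2 f hf
      rw [← hv.ring f hf, ← hw.ring f hf, h1, h2, mul_nonneg_iff_of_pos_right hotv,
        mul_nonneg_iff_of_pos_right hotw]
  · obtain ⟨f, hf, h1⟩ := hv.unif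
    obtain ⟨k, h2, -⟩ := main2 f hf
    rw [h1] at h2
    have : o t ∣ 1 := ⟨k, by rw [h2]; ring⟩
    exact Int.eq_one_of_dvd_one hotv.le this

end basics


section curve

variable {F : Type*} [Field F] [Algebra ℚ F] {v : ValuationSubring F} {o : F → ℤ}

/-- A polynomial expression of small degree in two functions. -/
def pf (c0 c1 c2 c3 c4 c5 d0 d1 : ℚ) (X Y : F) : F :=
  c0 + c1 * X + c2 * X ^ 2 + c3 * X ^ 3 + c4 * X ^ 4 + c5 * X ^ 5 + (d0 + d1 * X) * Y

/-- The value of `pf` at a point with rational coordinates. -/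
def pq (c0 c1 c2 c3 c4 c5 d0 d1 : ℚ) (a b : ℚ) : ℚ :=
  c0 + c1 * a + c2 * a ^ 2 + c3 * a ^ 3 + c4 * a ^ 4 + c5 * a ^ 5 + (d0 + d1 * a) * b

theorem res_pf (h : OrdAt v o) {X Y : F} {a b : ℚ} (hX : Res v X a) (hY : Res v Y b)
    (c0 c1 c2 c3 c4 c5 d0 d1 : ℚ) :
    Res v (pf c0 c1 c2 c3 c4 c5 d0 d1 X Y) (pq c0 c1 c2 c3 c4 c5 d0 d1 a b) :=
  ((((((Res.const c0).add ((Res.const c1).mul h hX)).add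
    ((Res.const c2).mul h (hX.pow h 2))).add
    ((Res.const c3).mul h (hX.pow h 3))).add
    ((Res.const c4).mul h (hX.pow h 4))).add
    ((Res.const c5).mul h (hX.pow h 5))).add
    (((Res.const d0).add ((Res.const d1).mul h hX)).mul h hY)

theorem val_pf (h : OrdAt v o) {X Y : F} (hX : v.valuation X ≤ 1) (hY : v.valuation Y ≤ 1)
    (c0 c1 c2 c3 c4 c5 d0 d1 : ℚ) :
    v.valuation (pf c0 c1 c2 c3 c4 c5 d0 d1 X Y) ≤ 1 := by
  rw [v.valuation_le_one_iff] at *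
  have q := h.rat
  unfold pf
  exact add_mem (add_mem (add_mem (add_mem (add_mem (add_mem (q _) (mul_mem (q _) hX))
    (mul_mem (q _) (pow_mem hX _))) (mul_mem (q _) (pow_mem hX _)))
    (mul_mem (q _) (pow_mem hX _))) (mul_mem (q _) (pow_mem hX _)))
    (mul_mem (add_mem (q _) (mul_mem (q _) hX)) hY)

theorem mem_pf {S : Subalgebra ℚ F} {X Y : F} (hX : X ∈ S) (hY : Y ∈ S)
    (c0 c1 c2 c3 c4 c5 d0 d1 : ℚ) : pf c0 c1 c2 c3 c4 c5 d0 d1 X Y ∈ S := by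
  have q : ∀ c : ℚ, (c : F) ∈ S := fun c => by simpa using S.algebraMap_mem c
  unfold pf
  exact add_mem (add_mem (add_mem (add_mem (add_mem (add_mem (q _) (mul_mem (q _) hX))
    (mul_mem (q _) (pow_mem hX _))) (mul_mem (q _) (pow_mem hX _)))
    (mul_mem (q _) (pow_mem hX _))) (mul_mem (q _) (pow_mem hX _)))
    (mul_mem (add_mem (q _) (mul_mem (q _) hX)) hY)

theorem gen_shift {X Y : F} (hgen : IntermediateField.adjoin ℚ ({X, Y} : Set F) = ⊤) (a b : ℚ) :
    IntermediateField.adjoin ℚ ({Y - b, X - a} : Set F) = ⊤ := by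
  rw [eq_top_iff, ← hgen, IntermediateField.adjoin_le_iff]
  have q : ∀ c : ℚ, (c : F) ∈ IntermediateField.adjoin ℚ ({Y - b, X - a} : Set F) :=
    fun c => by
      simpa using (IntermediateField.adjoin ℚ ({Y - b, X - a} : Set F)).algebraMap_mem c
  have h1 : Y - b ∈ IntermediateField.adjoin ℚ ({Y - b, X - a} : Set F) :=
    IntermediateField.subset_adjoin _ _ (by simp)
  have h2 : X - a ∈ IntermediateField.adjoin ℚ ({Y - b, X - a} : Set F) :=
    IntermediateField.subset_adjoin _ _ (by simp)
  rintro z (rfl | hz)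
  · have := add_mem h2 (q a)
    rwa [sub_add_cancel] at this
  · rw [Set.mem_singleton_iff] at hz
    subst hz
    have := add_mem h1 (q b)
    rwa [sub_add_cancel] at this

theorem shift_mem (X Y : F) (a b : ℚ) :
    X ∈ Algebra.adjoin ℚ ({Y - b, X - a} : Set F) ∧
      Y ∈ Algebra.adjoin ℚ ({Y - b, X - a} : Set F) := by
  have q : ∀ c : ℚ, (c : F) ∈ Algebra.adjoin ℚ ({Y - b, X - a} : Set F) :=
    fun c => by
      simpa using (Algebra.adjoin ℚ ({Y - b, X - a} : Set F)).algebraMap_mem c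
  have h1 : Y - b ∈ Algebra.adjoin ℚ ({Y - b, X - a} : Set F) :=
    Algebra.subset_adjoin (by simp)
  have h2 : X - a ∈ Algebra.adjoin ℚ ({Y - b, X - a} : Set F) :=
    Algebra.subset_adjoin (by simp)
  constructor
  · have := add_mem h2 (q a)
    rwa [sub_add_cancel] at this
  · have := add_mem h1 (q b)
    rwa [sub_add_cancel] at this

/-- Unramified rational points: uniqueness of the place and uniformizer `X - a`. -/
theorem key' {w : ValuationSubring F} {o' : F → ℤ} {X Y : F}
    (hv : OrdAt v o) (hw : OrdAt w o')
    (hgen : IntermediateField.adjoin ℚ ({X, Y} : Set F) = ⊤) {a b : ℚ}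
    (hXv : Res v X a) (hYv : Res v Y b) (hXw : Res w X a) (hYw : Res w Y b)
    (hX : X - a ≠ 0) (c0 c1 c2 c3 c4 c5 d0 d1 e0 e1 e2 e3 e4 e5 g0 g1 : ℚ)
    (hrel : (Y - b) * pf c0 c1 c2 c3 c4 c5 d0 d1 X Y =
      (X - a) * pf e0 e1 e2 e3 e4 e5 g0 g1 X Y)
    (hne : pq c0 c1 c2 c3 c4 c5 d0 d1 a b ≠ 0) : v = w ∧ o (X - a) = 1 :=
  key hv hw (gen_shift hgen a b) hYv hXv hYw hXw hX
    (mem_pf (shift_mem X Y a b).1 (shift_mem X Y a b).2 _ _ _ _ _ _ _ _)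
    (mem_pf (shift_mem X Y a b).1 (shift_mem X Y a b).2 _ _ _ _ _ _ _ _) hrel
    ((res_pf hv hXv hYv _ _ _ _ _ _ _ _).val_eq hv hne)
    ((res_pf hw hXw hYw _ _ _ _ _ _ _ _).val_eq hw hne)

theorem integral_quad {b c y : F} (hb : v.valuation b ≤ 1) (hc : v.valuation c ≤ 1)
    (hy : y ^ 2 + b * y = c) : v.valuation y ≤ 1 := by
  by_contra hlt
  rw [not_le] at hlt
  have h1 : v.valuation (y + b) = v.valuation y :=
    Valuation.map_add_eq_of_lt_left _ (hb.trans_lt hlt)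
  have h2 : v.valuation c = v.valuation y * v.valuation y := by
    rw [← hy, show y ^ 2 + b * y = (y + b) * y by ring, map_mul, h1]
  rw [h2] at hc
  exact absurd hc (not_le.2 (one_lt_mul'' hlt hlt))

/-- The data of the function field of the curve. -/
structure Curve (F : Type*) [Field F] [Algebra ℚ F] (x y : F) : Prop where
  eq : y ^ 2 + (2 * x ^ 3 - 3 * x ^ 2 - 41 * x + 110) * y = x ^ 3 - 51 * x ^ 2 + 425 * x + 179
  trans : Transcendental ℚ x
  gen : IntermediateField.adjoin ℚ ({x, y} : Set F) = ⊤

variable {x y : F}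

theorem Curve.sub_ne (C : Curve F x y) (a : ℚ) : x - a ≠ 0 := by
  intro h
  apply C.trans
  rw [sub_eq_zero.1 h]
  simpa using isAlgebraic_algebraMap (A := F) a

theorem Curve.x_ne (C : Curve F x y) : x ≠ 0 := by
  simpa using C.sub_ne 0

theorem Curve.n1 (C : Curve F x y) : x - 2 ≠ 0 := by simpa using C.sub_ne 2
theorem Curve.n2 (C : Curve F x y) : x - 4 ≠ 0 := by simpa using C.sub_ne 4
theorem Curve.n3 (C : Curve F x y) : x + 4 ≠ 0 := by simpa using C.sub_ne (-4)

/-- The three auxiliary functions and their conjugates. -/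
def f4 (_x y : F) : F := y + 49
def f4c (x y : F) : F := 49 - (2 * x ^ 3 - 3 * x ^ 2 - 41 * x + 110) - y
def f5 (x y : F) : F := y - 11 * x + 5
def f5c (x y : F) : F := 5 - 11 * x - (2 * x ^ 3 - 3 * x ^ 2 - 41 * x + 110) - y
def f6 (x y : F) : F :=
  121 * x ^ 4 - 1452 * x ^ 3 + 6776 * x ^ 2 - 13804 * x + 10320 + (20 * x - 48) * y
def f6c (x y : F) : F :=
  121 * x ^ 4 - 1452 * x ^ 3 + 6776 * x ^ 2 - 13804 * x + 10320
    - (20 * x - 48) * (2 * x ^ 3 - 3 * x ^ 2 - 41 * x + 110) - (20 * x - 48) * y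

theorem Curve.norm4 (C : Curve F x y) :
    f4 x y * f4c x y = ((-99 : ℚ) : F) * ((x + 4) * ((x - 2) * (x - 4))) := by
  unfold f4 f4c
  push_cast
  linear_combination - C.eq

theorem Curve.norm5 (C : Curve F x y) :
    f5 x y * f5c x y = ((22 : ℚ) : F) * ((x + 4) * (x - 2) ^ 3) := by
  unfold f5 f5c
  push_cast
  linear_combination - C.eq

theorem Curve.norm6 (C : Curve F x y) :
    f6 x y * f6c x y = ((9801 : ℚ) : F) * ((x - 2) ^ 2 * (x - 4) ^ 6) := by
  unfold f6 f6c
  push_cast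
  linear_combination - (20 * x - 48) ^ 2 * C.eq

theorem Curve.cz (_ : Curve F x y) : CharZero F := algebraRat.charZero F

theorem rat_ne (c : ℚ) (hc : c ≠ 0) : (c : F) ≠ 0 := by
  have : CharZero F := algebraRat.charZero F
  exact_mod_cast hc

theorem Curve.ne4 (C : Curve F x y) : f4 x y ≠ 0 ∧ f4c x y ≠ 0 := by
  rw [← mul_ne_zero_iff, C.norm4]
  exact mul_ne_zero (rat_ne _ (by norm_num)) (mul_ne_zero C.n3 (mul_ne_zero C.n1 C.n2))

theorem Curve.ne5 (C : Curve F x y) : f5 x y ≠ 0 ∧ f5c x y ≠ 0 := by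
  rw [← mul_ne_zero_iff, C.norm5]
  exact mul_ne_zero (rat_ne _ (by norm_num)) (mul_ne_zero C.n3 (pow_ne_zero _ C.n1))

theorem Curve.ne6 (C : Curve F x y) : f6 x y ≠ 0 ∧ f6c x y ≠ 0 := by
  rw [← mul_ne_zero_iff, C.norm6]
  exact mul_ne_zero (rat_ne _ (by norm_num))
    (mul_ne_zero (pow_ne_zero _ C.n1) (pow_ne_zero _ C.n2))

theorem OrdAt.const (h : OrdAt v o) (c : ℚ) (hc : c ≠ 0) : o (c : F) = 0 :=
  (Res.const c).ord h hc

theorem Curve.o4 (C : Curve F x y) (h : OrdAt v o) :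
    o (f4 x y) + o (f4c x y) = o (x + 4) + o (x - 2) + o (x - 4) := by
  rw [← h.mul _ _ C.ne4.1 C.ne4.2, C.norm4, h.mul _ _ (rat_ne _ (by norm_num))
    (mul_ne_zero C.n3 (mul_ne_zero C.n1 C.n2)), h.const _ (by norm_num),
    h.mul _ _ C.n3 (mul_ne_zero C.n1 C.n2), h.mul _ _ C.n1 C.n2]
  ring

theorem Curve.o5 (C : Curve F x y) (h : OrdAt v o) :
    o (f5 x y) + o (f5c x y) = o (x + 4) + 3 * o (x - 2) := by
  rw [← h.mul _ _ C.ne5.1 C.ne5.2, C.norm5, h.mul _ _ (rat_ne _ (by norm_num))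
    (mul_ne_zero C.n3 (pow_ne_zero _ C.n1)), h.const _ (by norm_num),
    h.mul _ _ C.n3 (pow_ne_zero _ C.n1), h.pow C.n1]
  push_cast
  ring

theorem Curve.o6 (C : Curve F x y) (h : OrdAt v o) :
    o (f6 x y) + o (f6c x y) = 2 * o (x - 2) + 6 * o (x - 4) := by
  rw [← h.mul _ _ C.ne6.1 C.ne6.2, C.norm6, h.mul _ _ (rat_ne _ (by norm_num))
    (mul_ne_zero (pow_ne_zero _ C.n1) (pow_ne_zero _ C.n2)), h.const _ (by norm_num),
    h.mul _ _ (pow_ne_zero _ C.n1) (pow_ne_zero _ C.n2), h.pow C.n1, h.pow C.n2]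
  push_cast
  ring

end curve

section tables

variable {F : Type*} [Field F] [Algebra ℚ F] {v w : ValuationSubring F} {o o' : F → ℤ} {x y : F}

theorem f4_pf : f4 x y = pf 49 0 0 0 0 0 1 0 x y := by
  unfold f4 pf; push_cast; ring
theorem f4c_pf : f4c x y = pf (-61) 41 3 (-2) 0 0 (-1) 0 x y := by
  unfold f4c pf; push_cast; ring
theorem f5_pf : f5 x y = pf 5 (-11) 0 0 0 0 1 0 x y := by
  unfold f5 pf; push_cast; ring
theorem f5c_pf : f5c x y = pf (-105) 30 3 (-2) 0 0 (-1) 0 x y := by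
  unfold f5c pf; push_cast; ring
theorem f6_pf : f6 x y = pf 10320 (-13804) 6776 (-1452) 121 0 (-48) 20 x y := by
  unfold f6 pf; push_cast; ring
theorem f6c_pf : f6c x y = pf 15600 (-17972) 7452 (-1296) 81 0 48 (-20) x y := by
  unfold f6c pf; push_cast; ring
theorem x2_pf : x - 2 = pf (-2) 1 0 0 0 0 0 0 x y := by
  unfold pf; push_cast; ring
theorem x4_pf : x - 4 = pf (-4) 1 0 0 0 0 0 0 x y := by
  unfold pf; push_cast; ring
theorem x4'_pf : x + 4 = pf 4 1 0 0 0 0 0 0 x y := by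
  unfold pf; push_cast; ring

/-- The orders of the six basic functions. -/
def Tab (o : F → ℤ) (x y : F) (a1 a2 a3 a4 a5 a6 : ℤ) : Prop :=
  o (x - 2) = a1 ∧ o (x - 4) = a2 ∧ o (x + 4) = a3 ∧ o (f4 x y) = a4 ∧ o (f5 x y) = a5 ∧
    o (f6 x y) = a6

theorem ord_pf0 (h : OrdAt v o) {X Y : F} {a b : ℚ} (hX : Res v X a) (hY : Res v Y b)
    {c0 c1 c2 c3 c4 c5 d0 d1 : ℚ} {f : F} (hf : f = pf c0 c1 c2 c3 c4 c5 d0 d1 X Y)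
    (hne : pq c0 c1 c2 c3 c4 c5 d0 d1 a b ≠ 0) : o f = 0 := by
  rw [hf]
  exact (res_pf h hX hY _ _ _ _ _ _ _ _).ord h hne

theorem ord_pf_pos (h : OrdAt v o) {X Y : F} {a b : ℚ} (hX : Res v X a) (hY : Res v Y b)
    {c0 c1 c2 c3 c4 c5 d0 d1 : ℚ} {f : F} (hf : f = pf c0 c1 c2 c3 c4 c5 d0 d1 X Y)
    (h0 : f ≠ 0) (hne : pq c0 c1 c2 c3 c4 c5 d0 d1 a b = 0) : 0 < o f := by
  have := res_pf h hX hY c0 c1 c2 c3 c4 c5 d0 d1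
  rw [hne, ← hf] at this
  exact this.ord_pos h h0

theorem ord_pf_nonneg (h : OrdAt v o) {X Y : F} (hX : v.valuation X ≤ 1)
    (hY : v.valuation Y ≤ 1)
    {c0 c1 c2 c3 c4 c5 d0 d1 : ℚ} {f : F} (hf : f = pf c0 c1 c2 c3 c4 c5 d0 d1 X Y)
    (h0 : f ≠ 0) : 0 ≤ o f := by
  rw [h.nonneg_iff h0, hf]
  exact val_pf h hX hY _ _ _ _ _ _ _ _

theorem uniq_Q1 (C : Curve F x y) (h : OrdAt v o) (h' : OrdAt w o')
    (hx : Res v x 2) (hy : Res v y 17) (hx' : Res w x 2) (hy' : Res w y 17) :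
    v = w ∧ o (x - 2) = 1 := by
  have := key' h h' C.gen hx hy hx' hy' (C.sub_ne 2) 127 (-41) (-3) 2 0 0 1 0
    990 (-66) (-33) 0 0 0 0 0 (by unfold pf; push_cast; linear_combination C.eq)
    (by norm_num [pq])
  simpa using this

theorem tab_Q1 (C : Curve F x y) (h : OrdAt v o) (hx : Res v x 2) (hy : Res v y 17) :
    Tab o x y 1 0 0 0 3 2 := by
  have h1 := (uniq_Q1 C h h hx hy hx hy).2
  have h2 := ord_pf0 h hx hy x4_pf (by norm_num [pq])
  have h3 := ord_pf0 h hx hy x4'_pf (by norm_num [pq])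
  have h4 := ord_pf0 h hx hy f4_pf (by norm_num [pq])
  have h5 := ord_pf0 h hx hy f5c_pf (by norm_num [pq])
  have h6 := ord_pf0 h hx hy f6c_pf (by norm_num [pq])
  have n5 := C.o5 h
  have n6 := C.o6 h
  unfold Tab
  omega

theorem uniq_R1 (C : Curve F x y) (h : OrdAt v o) (h' : OrdAt w o')
    (hx : Res v x 2) (hy : Res v y (-49)) (hx' : Res w x 2) (hy' : Res w y (-49)) :
    v = w ∧ o (x - 2) = 1 := by
  have := key' h h' C.gen hx hy hx' hy' (C.sub_ne 2) 61 (-41) (-3) 2 0 0 1 0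
    (-1584) 0 99 0 0 0 0 0 (by unfold pf; push_cast; linear_combination C.eq)
    (by norm_num [pq])
  simpa using this

theorem tab_R1 (C : Curve F x y) (h : OrdAt v o) (hx : Res v x 2) (hy : Res v y (-49)) :
    Tab o x y 1 0 0 1 0 0 := by
  have h1 := (uniq_R1 C h h hx hy hx hy).2
  have h2 := ord_pf0 h hx hy x4_pf (by norm_num [pq])
  have h3 := ord_pf0 h hx hy x4'_pf (by norm_num [pq])
  have h4 := ord_pf0 h hx hy f4c_pf (by norm_num [pq])
  have h5 := ord_pf0 h hx hy f5_pf (by norm_num [pq])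
  have h6 := ord_pf0 h hx hy f6_pf (by norm_num [pq])
  have n4 := C.o4 h
  unfold Tab
  omega

theorem uniq_Q2 (C : Curve F x y) (h : OrdAt v o) (h' : OrdAt w o')
    (hx : Res v x 4) (hy : Res v y 23) (hx' : Res w x 4) (hy' : Res w y 23) :
    v = w ∧ o (x - 4) = 1 := by
  have := key' h h' C.gen hx hy hx' hy' (C.sub_ne 4) 133 (-41) (-3) 2 0 0 1 0
    720 (-162) (-45) 0 0 0 0 0 (by unfold pf; push_cast; linear_combination C.eq)
    (by norm_num [pq])
  simpa using this

theorem tab_Q2 (C : Curve F x y) (h : OrdAt v o) (hx : Res v x 4) (hy : Res v y 23) :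
    Tab o x y 0 1 0 0 0 0 := by
  have h1 := (uniq_Q2 C h h hx hy hx hy).2
  have h2 := ord_pf0 h hx hy x2_pf (by norm_num [pq])
  have h3 := ord_pf0 h hx hy x4'_pf (by norm_num [pq])
  have h4 := ord_pf0 h hx hy f4_pf (by norm_num [pq])
  have h5 := ord_pf0 h hx hy f5_pf (by norm_num [pq])
  have h6 := ord_pf0 h hx hy f6_pf (by norm_num [pq])
  unfold Tab
  omega

theorem uniq_R2 (C : Curve F x y) (h : OrdAt v o) (h' : OrdAt w o')
    (hx : Res v x 4) (hy : Res v y (-49)) (hx' : Res w x 4) (hy' : Res w y (-49)) :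
    v = w ∧ o (x - 4) = 1 := by
  have := key' h h' C.gen hx hy hx' hy' (C.sub_ne 4) 61 (-41) (-3) 2 0 0 1 0
    (-792) 198 99 0 0 0 0 0 (by unfold pf; push_cast; linear_combination C.eq)
    (by norm_num [pq])
  simpa using this

theorem tab_R2 (C : Curve F x y) (h : OrdAt v o) (hx : Res v x 4) (hy : Res v y (-49)) :
    Tab o x y 0 1 0 1 0 6 := by
  have h1 := (uniq_R2 C h h hx hy hx hy).2
  have h2 := ord_pf0 h hx hy x2_pf (by norm_num [pq])
  have h3 := ord_pf0 h hx hy x4'_pf (by norm_num [pq])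
  have h4 := ord_pf0 h hx hy f4c_pf (by norm_num [pq])
  have h5 := ord_pf0 h hx hy f5_pf (by norm_num [pq])
  have h6 := ord_pf0 h hx hy f6c_pf (by norm_num [pq])
  have n4 := C.o4 h
  have n6 := C.o6 h
  unfold Tab
  omega

theorem tab_W (C : Curve F x y) (h : OrdAt v o) (hx : Res v x (-4)) (hy : Res v y (-49)) :
    Tab o x y 0 0 2 1 1 0 := by
  have hs : v.valuation (x - ((-4 : ℚ) : F)) < 1 := hx
  have ht : v.valuation (y - ((-49 : ℚ) : F)) < 1 := hy
  have e4 : y - ((-49 : ℚ) : F) = f4 x y := by unfold f4; push_cast; ring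
  have e3 : x - ((-4 : ℚ) : F) = x + 4 := by push_cast; ring
  have hm := shift_mem y x (-49) (-4)
  have hgen' : IntermediateField.adjoin ℚ ({y, x} : Set F) = ⊤ := by
    rw [Set.pair_comm]; exact C.gen
  have hk := key h h (gen_shift hgen' (-49) (-4)) hs ht hs ht (by rw [e4]; exact C.ne4.1)
    (q := pf 792 (-594) 99 0 0 0 0 0 x y) (r := pf 61 (-41) (-3) 2 0 0 1 0 x y)
    (mem_pf hm.2 hm.1 _ _ _ _ _ _ _ _) (mem_pf hm.2 hm.1 _ _ _ _ _ _ _ _)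
    (by unfold pf; push_cast; linear_combination - C.eq)
    ((res_pf h hx hy _ _ _ _ _ _ _ _).val_eq h (by norm_num [pq]))
    ((res_pf h hx hy _ _ _ _ _ _ _ _).val_eq h (by norm_num [pq]))
  have h4 := hk.2
  rw [e4] at h4
  have h1 := ord_pf0 h hx hy x2_pf (by norm_num [pq])
  have h2 := ord_pf0 h hx hy x4_pf (by norm_num [pq])
  have h6 := ord_pf0 h hx hy f6_pf (by norm_num [pq])
  have h5 := ord_pf_pos h hx hy f5_pf C.ne5.1 (by norm_num [pq])
  have h5' := ord_pf_pos h hx hy f5c_pf C.ne5.2 (by norm_num [pq])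
  have h3 : o (x + 4) = 2 := by
    have r1 := res_pf h hx hy 792 (-594) 99 0 0 0 0 0
    have r2 := (res_pf h hx hy 49 0 0 0 0 0 1 0).mul h (res_pf h hx hy 3 (-11) 2 0 0 0 0 0)
    have r3 := r1.sub r2
    have ne : pq 792 (-594) 99 0 0 0 0 0 (-4) (-49) -
      pq 49 0 0 0 0 0 1 0 (-4) (-49) * pq 3 (-11) 2 0 0 0 0 0 (-4) (-49) ≠ 0 := by
      norm_num [pq]
    have e : (x + 4) * (pf 792 (-594) 99 0 0 0 0 0 x y -
        pf 49 0 0 0 0 0 1 0 x y * pf 3 (-11) 2 0 0 0 0 0 x y) = f4 x y ^ 2 := by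
      unfold pf f4
      push_cast
      linear_combination - C.eq
    have := congrArg o e
    rw [h.mul _ _ C.n3 (r3.ne h ne), r3.ord h ne, h.pow C.ne4.1, h4] at this
    simpa using this
  have n5 := C.o5 h
  unfold Tab
  omega

theorem tab_other (C : Curve F x y) (h : OrdAt v o) (hx : v.valuation x ≤ 1)
    (hy : v.valuation y ≤ 1) (h1 : o (x - 2) = 0) (h2 : o (x - 4) = 0) (h3 : o (x + 4) = 0) :
    Tab o x y 0 0 0 0 0 0 := by
  have a4 := ord_pf_nonneg h hx hy f4_pf C.ne4.1
  have b4 := ord_pf_nonneg h hx hy f4c_pf C.ne4.2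
  have a5 := ord_pf_nonneg h hx hy f5_pf C.ne5.1
  have b5 := ord_pf_nonneg h hx hy f5c_pf C.ne5.2
  have a6 := ord_pf_nonneg h hx hy f6_pf C.ne6.1
  have b6 := ord_pf_nonneg h hx hy f6c_pf C.ne6.2
  have n4 := C.o4 h
  have n5 := C.o5 h
  have n6 := C.o6 h
  unfold Tab
  omega

/-! Places at infinity. -/

theorem Curve.eq_inf (C : Curve F x y) : (y / x ^ 3) ^ 2 +
    (2 - 3 * x⁻¹ - 41 * x⁻¹ ^ 2 + 110 * x⁻¹ ^ 3) * (y / x ^ 3) =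
      x⁻¹ ^ 3 - 51 * x⁻¹ ^ 4 + 425 * x⁻¹ ^ 5 + 179 * x⁻¹ ^ 6 := by
  have := C.x_ne
  field_simp
  linear_combination C.eq

theorem Curve.gen_inf (C : Curve F x y) :
    IntermediateField.adjoin ℚ ({x⁻¹, y / x ^ 3} : Set F) = ⊤ := by
  rw [eq_top_iff, ← C.gen, IntermediateField.adjoin_le_iff]
  have h1 : x⁻¹ ∈ IntermediateField.adjoin ℚ ({x⁻¹, y / x ^ 3} : Set F) :=
    IntermediateField.subset_adjoin _ _ (by simp)
  have h2 : y / x ^ 3 ∈ IntermediateField.adjoin ℚ ({x⁻¹, y / x ^ 3} : Set F) :=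
    IntermediateField.subset_adjoin _ _ (by simp)
  have h3 : x ∈ IntermediateField.adjoin ℚ ({x⁻¹, y / x ^ 3} : Set F) := by
    simpa using inv_mem h1
  rintro z (rfl | hz)
  · exact h3
  · rw [Set.mem_singleton_iff] at hz
    subst hz
    have := mul_mem h2 (pow_mem h3 3)
    rwa [div_mul_cancel₀ _ (pow_ne_zero _ C.x_ne)] at this

theorem uniq_Pb (C : Curve F x y) (h : OrdAt v o) (h' : OrdAt w o')
    (hx : Res v x⁻¹ 0) (hy : Res v (y / x ^ 3) 0) (hx' : Res w x⁻¹ 0)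
    (hy' : Res w (y / x ^ 3) 0) : v = w ∧ o x = -1 := by
  have := key' h h' C.gen_inf hx hy hx' hy' (by simpa using C.x_ne) 2 (-3) (-41) 110 0 0 1 0
    0 0 1 (-51) 425 179 0 0 (by unfold pf; push_cast; linear_combination C.eq_inf)
    (by norm_num [pq])
  simp only [Rat.cast_zero, sub_zero, h.inv C.x_ne] at this
  exact ⟨this.1, by omega⟩

theorem uniq_Pa (C : Curve F x y) (h : OrdAt v o) (h' : OrdAt w o')
    (hx : Res v x⁻¹ 0) (hy : Res v (y / x ^ 3) (-2)) (hx' : Res w x⁻¹ 0)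
    (hy' : Res w (y / x ^ 3) (-2)) : v = w ∧ o x = -1 := by
  have := key' h h' C.gen_inf hx hy hx' hy' (by simpa using C.x_ne) 0 (-3) (-41) 110 0 0 1 0
    (-6) (-82) 221 (-51) 425 179 0 0 (by unfold pf; push_cast; linear_combination C.eq_inf)
    (by norm_num [pq])
  simp only [Rat.cast_zero, sub_zero, h.inv C.x_ne] at this
  exact ⟨this.1, by omega⟩

theorem ord_inf (C : Curve F x y) (h : OrdAt v o) (ho : o x = -1) {b : ℚ}
    (hx : Res v x⁻¹ 0) (hy : Res v (y / x ^ 3) b)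
    {c0 c1 c2 c3 c4 c5 d0 d1 : ℚ} {f : F} (n : ℕ)
    (hf : f = x ^ n * pf c0 c1 c2 c3 c4 c5 d0 d1 x⁻¹ (y / x ^ 3))
    (hne : pq c0 c1 c2 c3 c4 c5 d0 d1 0 b ≠ 0) : o f = -n := by
  have r := res_pf h hx hy c0 c1 c2 c3 c4 c5 d0 d1
  rw [hf, h.mul _ _ (pow_ne_zero _ C.x_ne) (r.ne h hne), r.ord h hne, h.pow C.x_ne, ho]
  ring

theorem tab_Pb (C : Curve F x y) (h : OrdAt v o) (hx : Res v x⁻¹ 0)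
    (hy : Res v (y / x ^ 3) 0) : Tab o x y (-1) (-1) (-1) 0 (-1) (-4) := by
  have ho := (uniq_Pb C h h hx hy hx hy).2
  have hx0 := C.x_ne
  have h1 := ord_inf C h ho hx hy (f := x - 2) 1 (c0 := 1) (c1 := -2) (c2 := 0) (c3 := 0)
    (c4 := 0) (c5 := 0) (d0 := 0) (d1 := 0) (by unfold pf; push_cast; field_simp; ring)
    (by norm_num [pq])
  have h2 := ord_inf C h ho hx hy (f := x - 4) 1 (c0 := 1) (c1 := -4) (c2 := 0) (c3 := 0)
    (c4 := 0) (c5 := 0) (d0 := 0) (d1 := 0) (by unfold pf; push_cast; field_simp; ring)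
    (by norm_num [pq])
  have h3 := ord_inf C h ho hx hy (f := x + 4) 1 (c0 := 1) (c1 := 4) (c2 := 0) (c3 := 0)
    (c4 := 0) (c5 := 0) (d0 := 0) (d1 := 0) (by unfold pf; push_cast; field_simp; ring)
    (by norm_num [pq])
  have h4 := ord_inf C h ho hx hy (f := f4c x y) 3 (c0 := -2) (c1 := 3) (c2 := 41) (c3 := -61)
    (c4 := 0) (c5 := 0) (d0 := -1) (d1 := 0) (by unfold pf f4c; push_cast; field_simp; ring)
    (by norm_num [pq])
  have h5 := ord_inf C h ho hx hy (f := f5c x y) 3 (c0 := -2) (c1 := 3) (c2 := 30) (c3 := -105)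
    (c4 := 0) (c5 := 0) (d0 := -1) (d1 := 0) (by unfold pf f5c; push_cast; field_simp; ring)
    (by norm_num [pq])
  have h6 := ord_inf C h ho hx hy (f := f6 x y) 4 (c0 := 121) (c1 := -1452) (c2 := 6776)
    (c3 := -13804) (c4 := 10320) (c5 := 0) (d0 := 20) (d1 := -48)
    (by unfold pf f6; push_cast; field_simp; ring) (by norm_num [pq])
  have n4 := C.o4 h
  have n5 := C.o5 h
  unfold Tab
  push_cast at *
  omega

theorem tab_Pa (C : Curve F x y) (h : OrdAt v o) (hx : Res v x⁻¹ 0)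
    (hy : Res v (y / x ^ 3) (-2)) : Tab o x y (-1) (-1) (-1) (-3) (-3) (-4) := by
  have ho := (uniq_Pa C h h hx hy hx hy).2
  have hx0 := C.x_ne
  have h1 := ord_inf C h ho hx hy (f := x - 2) 1 (c0 := 1) (c1 := -2) (c2 := 0) (c3 := 0)
    (c4 := 0) (c5 := 0) (d0 := 0) (d1 := 0) (by unfold pf; push_cast; field_simp; ring)
    (by norm_num [pq])
  have h2 := ord_inf C h ho hx hy (f := x - 4) 1 (c0 := 1) (c1 := -4) (c2 := 0) (c3 := 0)
    (c4 := 0) (c5 := 0) (d0 := 0) (d1 := 0) (by unfold pf; push_cast; field_simp; ring)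
    (by norm_num [pq])
  have h3 := ord_inf C h ho hx hy (f := x + 4) 1 (c0 := 1) (c1 := 4) (c2 := 0) (c3 := 0)
    (c4 := 0) (c5 := 0) (d0 := 0) (d1 := 0) (by unfold pf; push_cast; field_simp; ring)
    (by norm_num [pq])
  have h4 := ord_inf C h ho hx hy (f := f4 x y) 3 (c0 := 0) (c1 := 0) (c2 := 0) (c3 := 49)
    (c4 := 0) (c5 := 0) (d0 := 1) (d1 := 0) (by unfold pf f4; push_cast; field_simp; ring)
    (by norm_num [pq])
  have h5 := ord_inf C h ho hx hy (f := f5 x y) 3 (c0 := 0) (c1 := 0) (c2 := -11) (c3 := 5)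
    (c4 := 0) (c5 := 0) (d0 := 1) (d1 := 0) (by unfold pf f5; push_cast; field_simp; ring)
    (by norm_num [pq])
  have h6 := ord_inf C h ho hx hy (f := f6 x y) 4 (c0 := 121) (c1 := -1452) (c2 := 6776)
    (c3 := -13804) (c4 := 10320) (c5 := 0) (d0 := 20) (d1 := -48)
    (by unfold pf f6; push_cast; field_simp; ring) (by norm_num [pq])
  unfold Tab
  push_cast at *
  omega

/-- Splitting of fibres. -/
theorem res_split {Y : F} {b b' : ℚ} (hp : Res v ((Y - b) * (Y - b')) 0) :
    Res v Y b ∨ Res v Y b' := by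
  have h1 := hp.lt
  rw [map_mul] at h1
  by_contra hc
  rw [not_or] at hc
  unfold Res at hc
  rw [not_lt, not_lt] at hc
  exact absurd h1 (not_lt.2 (one_le_mul hc.1 hc.2))

theorem fibre (C : Curve F x y) (h : OrdAt v o) {a b b' : ℚ} (hx : Res v x a)
    (hy : v.valuation y ≤ 1)
    (h1 : pq 110 (-41) (-3) 2 0 0 0 0 a 0 = - (b + b'))
    (h2 : pq 179 425 (-51) 1 0 0 0 0 a 0 = - (b * b')) : Res v y b ∨ Res v y b' := by
  apply res_split
  have r1 := res_pf h hx (Res.const (v := v) 0) 110 (-41) (-3) 2 0 0 0 0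
  have r2 := res_pf h hx (Res.const (v := v) 0) 179 425 (-51) 1 0 0 0 0
  rw [h1] at r1
  rw [h2] at r2
  have cz := C.cz
  have e : (y - b) * (y - b') =
      (pf 179 425 (-51) 1 0 0 0 0 x ((0 : ℚ) : F) - ((-(b * b') : ℚ) : F)) +
      -(y * (pf 110 (-41) (-3) 2 0 0 0 0 x ((0 : ℚ) : F) - ((-(b + b') : ℚ) : F))) := by
    unfold pf
    push_cast
    linear_combination C.eq
  unfold Res
  rw [Rat.cast_zero, sub_zero, e]
  apply v.valuation.map_add_lt r2
  rw [Valuation.map_neg]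
  exact mul_lt_of_le hy r1

theorem val_y (C : Curve F x y) (h : OrdAt v o) (hx : v.valuation x ≤ 1) :
    v.valuation y ≤ 1 := by
  have r1 := val_pf h hx (h.val_rat 0) 110 (-41) (-3) 2 0 0 0 0
  have r2 := val_pf h hx (h.val_rat 0) 179 425 (-51) 1 0 0 0 0
  refine integral_quad r1 r2 ?_
  unfold pf
  push_cast
  linear_combination C.eq

theorem inf_split (C : Curve F x y) (h : OrdAt v o) (hx : Res v x⁻¹ 0) :
    Res v (y / x ^ 3) (-2) ∨ Res v (y / x ^ 3) 0 := by
  have hx1 := hx.le h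
  have r1 := val_pf h hx1 (h.val_rat 0) 2 (-3) (-41) 110 0 0 0 0
  have r2 := val_pf h hx1 (h.val_rat 0) 0 0 0 1 (-51) 425 0 0
  have r3 : v.valuation (pf 0 0 0 1 (-51) 425 0 0 x⁻¹ ((0 : ℚ) : F) +
      ((179 : ℚ) : F) * x⁻¹ ^ 6) ≤ 1 := by
    refine v.valuation.map_add_le r2 ?_
    rw [map_mul, map_pow]
    exact mul_le_one' (h.val_rat _) (pow_le_one' hx1 _)
  have hz : v.valuation (y / x ^ 3) ≤ 1 := by
    refine integral_quad r1 r3 ?_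
    unfold pf
    push_cast
    linear_combination C.eq_inf
  apply res_split
  have e : (y / x ^ 3 - ((-2 : ℚ) : F)) * (y / x ^ 3 - ((0 : ℚ) : F)) - ((0 : ℚ) : F) =
      (pf 3 41 (-110) 0 0 0 0 0 x⁻¹ ((0 : ℚ) : F) * (y / x ^ 3) +
        (pf 0 0 1 (-51) 425 179 0 0 x⁻¹ ((0 : ℚ) : F))) * x⁻¹ := by
    unfold pf
    push_cast
    linear_combination C.eq_inf
  unfold Res
  rw [e]
  refine mul_lt_of_le (v.valuation.map_add_le ?_ ?_) hx.lt
  · rw [map_mul]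
    exact mul_le_one' (val_pf h hx1 (h.val_rat 0) _ _ _ _ _ _ _ _) hz
  · exact val_pf h hx1 (h.val_rat 0) _ _ _ _ _ _ _ _

/-- Classification of places. -/
theorem classify (C : Curve F x y) (h : OrdAt v o) :
    (Res v x⁻¹ 0 ∧ Res v (y / x ^ 3) (-2)) ∨ (Res v x⁻¹ 0 ∧ Res v (y / x ^ 3) 0) ∨
    (Res v x 2 ∧ Res v y 17) ∨ (Res v x 2 ∧ Res v y (-49)) ∨
    (Res v x 4 ∧ Res v y 23) ∨ (Res v x 4 ∧ Res v y (-49)) ∨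
    (Res v x (-4) ∧ Res v y (-49)) ∨
    (v.valuation x ≤ 1 ∧ Tab o x y 0 0 0 0 0 0) := by
  by_cases hx : v.valuation x ≤ 1
  · have hy := val_y C h hx
    by_cases c2 : Res v x 2
    · have := fibre C h (b := 17) (b' := -49) c2 hy (by norm_num [pq]) (by norm_num [pq])
      rcases this with hb | hb
      · exact Or.inr (Or.inr (Or.inl ⟨c2, hb⟩))
      · exact Or.inr (Or.inr (Or.inr (Or.inl ⟨c2, hb⟩)))
    by_cases c4 : Res v x 4
    · have := fibre C h (b := 23) (b' := -49) c4 hy (by norm_num [pq]) (by norm_num [pq])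
      rcases this with hb | hb
      · exact Or.inr (Or.inr (Or.inr (Or.inr (Or.inl ⟨c4, hb⟩))))
      · exact Or.inr (Or.inr (Or.inr (Or.inr (Or.inr (Or.inl ⟨c4, hb⟩)))))
    by_cases c4' : Res v x (-4)
    · have := fibre C h (b := -49) (b' := -49) c4' hy (by norm_num [pq]) (by norm_num [pq])
      exact Or.inr (Or.inr (Or.inr (Or.inr (Or.inr (Or.inr (Or.inl ⟨c4', this.elim id id⟩))))))
    have z : ∀ c : ℚ, ¬ Res v x c → o (x - c) = 0 := by
      intro c hc
      rw [h.zero_iff (C.sub_ne c)]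
      refine le_antisymm ?_ (not_lt.1 hc)
      exact v.valuation.map_sub_le hx (h.val_rat c)
    have z2 := z 2 c2
    have z4 := z 4 c4
    have z4' := z (-4) c4'
    simp only [Rat.cast_neg, Rat.cast_ofNat, sub_neg_eq_add] at z2 z4 z4'
    have := tab_other C h hx hy z2 z4 z4'
    exact Or.inr (Or.inr (Or.inr (Or.inr (Or.inr (Or.inr (Or.inr (⟨hx, this⟩)))))))
  · have hx' : Res v x⁻¹ 0 := by
      unfold Res
      rw [Rat.cast_zero, sub_zero, map_inv₀]
      rw [not_le] at hx
      exact inv_lt_one_of_one_lt₀ hx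
    have := inf_split C h hx'
    rcases this with hb | hb
    · exact Or.inl ⟨hx', hb⟩
    · exact Or.inr (Or.inl ⟨hx', hb⟩)

end tables

section algebraic

open Polynomial

/-- Integral elements of a quadratic extension `K(√Δ)` with `Δ` squarefree. -/
theorem int_repr {R K F : Type*} [CommRing R] [IsDomain R] [UniqueFactorizationMonoid R]
    [Field K] [Algebra R K] [IsFractionRing R K]
    [Field F] [Algebra K F] [Algebra R F] [IsScalarTower R K F] {u g : F} {D : R}
    (h2 : IsUnit (2 : R)) (hD : Squarefree D) (hD0 : D ≠ 0) (hu : u ^ 2 = algebraMap R F D)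
    (T B : K) (hg : g = algebraMap K F T + algebraMap K F B * u) (hi : IsIntegral R g) :
    ∃ t b : R, g = algebraMap R F t + algebraMap R F b * u := by
  have inj : Function.Injective (algebraMap K F) := (algebraMap K F).injective
  by_cases hr : g ∈ (algebraMap K F).range
  · obtain ⟨k, rfl⟩ := hr
    rw [isIntegral_algebraMap_iff inj] at hi
    obtain ⟨t, rfl⟩ := IsIntegrallyClosed.isIntegral_iff.1 hi
    exact ⟨t, 0, by rw [map_zero, zero_mul, add_zero, ← IsScalarTower.algebraMap_apply]⟩
  · have hiK : IsIntegral K g := hi.tower_top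
    have hdeg := (minpoly.two_le_natDegree_iff hiK).2 hr
    have hmin := minpoly.isIntegrallyClosed_eq_field_fractions' K hi
    set d : K := algebraMap R K D with hd
    set Q : K[X] := X ^ 2 + (C (- 2 * T) * X + C (T ^ 2 - B ^ 2 * d)) with hQ
    have hlow : (C (- 2 * T) * X + C (T ^ 2 - B ^ 2 * d)).natDegree ≤ 1 := by
      compute_degree
    have hQm : Q.Monic := by
      rw [hQ]; monicity!
    have hQd : Q.natDegree ≤ 2 := by
      rw [hQ]; compute_degree
    have hQr : aeval g Q = 0 := by
      rw [hQ, hg]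
      simp only [map_add, map_mul, map_pow, aeval_X, aeval_C, map_sub, map_neg, map_ofNat]
      have : algebraMap K F d = u ^ 2 := by rw [hu, hd, ← IsScalarTower.algebraMap_apply]
      rw [this]
      ring
    have hdvd : minpoly K g ∣ Q := minpoly.dvd K g hQr
    have heq : Q = minpoly K g :=
      Polynomial.eq_of_monic_of_dvd_of_natDegree_le (minpoly.monic hiK) hQm hdvd (hQd.trans hdeg)
    have c0 : T ^ 2 - B ^ 2 * d = algebraMap R K ((minpoly R g).coeff 0) := by
      rw [← coeff_map, ← hmin, ← heq, hQ]
      simp only [coeff_add, coeff_X_pow, coeff_C_mul, coeff_X, coeff_C]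
      norm_num
    have c1 : - 2 * T = algebraMap R K ((minpoly R g).coeff 1) := by
      rw [← coeff_map, ← hmin, ← heq, hQ]
      simp only [coeff_add, coeff_X_pow, coeff_C_mul, coeff_X, coeff_C]
      norm_num
    obtain ⟨h, hh⟩ := h2.exists_right_inv
    have hhK : (2 : K) * algebraMap R K h = 1 := by
      have := congrArg (algebraMap R K) hh
      rwa [← one_add_one_eq_two, map_mul, map_add, map_one, one_add_one_eq_two] at this
    set t : R := - h * (minpoly R g).coeff 1 with ht
    have hT : T = algebraMap R K t := by
      rw [ht, map_mul, ← c1, map_neg]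
      linear_combination (-T) * hhK
    have hB : (B * d) ^ 2 = algebraMap R K ((t ^ 2 - (minpoly R g).coeff 0) * D) := by
      rw [map_mul, map_sub, ← c0, map_pow, ← hT]
      ring
    have hBi : IsIntegral R (B * d) := by
      refine IsIntegral.of_pow (n := 2) (by norm_num) ?_
      rw [hB]
      exact isIntegral_algebraMap
    obtain ⟨e, he⟩ := IsIntegrallyClosed.isIntegral_iff.1 hBi
    have hdv : D ∣ e ^ 2 := by
      refine ⟨t ^ 2 - (minpoly R g).coeff 0, IsFractionRing.injective R K ?_⟩
      rw [map_pow, he, hB, mul_comm]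
    obtain ⟨b, hb⟩ := (hD.dvd_pow_iff_dvd two_ne_zero).1 hdv
    have hd0 : d ≠ 0 := by
      rw [hd]
      exact (map_ne_zero_iff _ (IsFractionRing.injective R K)).2 hD0
    have hBb : B = algebraMap R K b := by
      apply mul_right_cancel₀ hd0
      rw [← he, hb, map_mul, mul_comm]
    refine ⟨t, b, ?_⟩
    rw [hg, hT, hBb, ← IsScalarTower.algebraMap_apply, ← IsScalarTower.algebraMap_apply]

/-- A quadratic extension is spanned by `1` and `u`. -/
theorem quad_span {K F : Type*} [Field K] [Field F] [Algebra K F] {u : F} {d : K}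
    (hu : u ^ 2 = algebraMap K F d) (htop : IntermediateField.adjoin K {u} = ⊤) (g : F) :
    ∃ T B : K, g = algebraMap K F T + algebraMap K F B * u := by
  have halg : IsAlgebraic K u := by
    refine IsIntegral.isAlgebraic (IsIntegral.of_pow (n := 2) (by norm_num) ?_)
    rw [hu]
    exact isIntegral_algebraMap
  have hg : g ∈ Algebra.adjoin K {u} := by
    rw [← IntermediateField.adjoin_simple_toSubalgebra_of_isAlgebraic halg, htop]
    trivial
  induction hg using Algebra.adjoin_induction with
  | mem z hz =>
    rw [Set.mem_singleton_iff] at hz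
    exact ⟨0, 1, by simp [hz]⟩
  | algebraMap r => exact ⟨r, 0, by simp⟩
  | add a b _ _ ha hb =>
    obtain ⟨T, B, h1⟩ := ha
    obtain ⟨T', B', h2⟩ := hb
    exact ⟨T + T', B + B', by rw [h1, h2, map_add, map_add]; ring⟩
  | mul a b _ _ ha hb =>
    obtain ⟨T, B, h1⟩ := ha
    obtain ⟨T', B', h2⟩ := hb
    refine ⟨T * T' + B * B' * d, T * B' + B * T', ?_⟩
    rw [h1, h2]
    simp only [map_add, map_mul]
    rw [← hu]
    ring

end algebraic

section repr

open Polynomial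

/-- The discriminant polynomial of the curve. -/
noncomputable def DD : ℚ[X] :=
  4 * X ^ 6 - 12 * X ^ 5 - 155 * X ^ 4 + 690 * X ^ 3 + 817 * X ^ 2 - 7320 * X + 12816

theorem DD_deriv : derivative DD =
    24 * X ^ 5 - 60 * X ^ 4 - 620 * X ^ 3 + 2070 * X ^ 2 + 1634 * X - 7320 := by
  have hn : ∀ n : ℕ, derivative ((n : ℚ[X])) = 0 := fun n => derivative_natCast
  have e : DD = ((4 : ℕ) : ℚ[X]) * X ^ 6 - ((12 : ℕ) : ℚ[X]) * X ^ 5 - ((155 : ℕ) : ℚ[X]) * X ^ 4 + ((690 : ℕ) : ℚ[X]) * X ^ 3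
      + ((817 : ℕ) : ℚ[X]) * X ^ 2 - ((7320 : ℕ) : ℚ[X]) * X + ((12816 : ℕ) : ℚ[X]) := by
    unfold DD; push_cast; ring
  rw [e]
  simp only [derivative_add, derivative_sub, derivative_mul, derivative_X_pow, derivative_X, hn]
  simp only [map_natCast]
  push_cast
  ring

theorem DD_sqf : Squarefree DD := by
  apply Polynomial.Separable.squarefree
  refine ⟨C (1 / 16779697250494464) * (3096718750014 + 949868188658 * X - 212191831348 * X ^ 2
      - 19672839828 * X ^ 3 + 5129493960 * X ^ 4),
    C (1 / 16779697250494464) * (3129487739028 - 735093931515 * X - 254859330202 * X ^ 2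
      + 45837207089 * X ^ 3 + 3706264468 * X ^ 4 - 854915660 * X ^ 5), ?_⟩
  have hC : (C (1 / 16779697250494464 : ℚ)) * (16779697250494464 : ℚ[X]) = 1 := by
    have : (16779697250494464 : ℚ[X]) = C (16779697250494464 : ℚ) :=
      (map_ofNat C _).symm
    rw [this, ← C_mul]
    norm_num
  rw [DD_deriv]
  unfold DD
  linear_combination hC

theorem DD_ne : DD ≠ 0 := DD_sqf.ne_zero

variable {F : Type*} [Field F] [Algebra ℚ F] {x y : F}

/-- The square root of the discriminant. -/
def uu (x y : F) : F := 2 * y + (2 * x ^ 3 - 3 * x ^ 2 - 41 * x + 110)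

theorem Curve.u_sq (C : Curve F x y) : uu x y ^ 2 = aeval x DD := by
  unfold DD uu
  simp only [map_add, map_sub, map_mul, map_pow, aeval_X, map_ofNat]
  linear_combination 4 * C.eq

theorem Curve.repr (H : Curve F x y) {g : F}
    (hg : ∀ v : ValuationSubring F, (∀ a : ℚ, (a : F) ∈ v) → x ∈ v → g ∈ v) :
    ∃ A B : ℚ[X], g = aeval x A + aeval x B * uu x y := by
  let : Algebra ℚ[X] F := (aeval x : ℚ[X] →ₐ[ℚ] F).toRingHom.toAlgebra
  have hmap : ∀ p : ℚ[X], algebraMap ℚ[X] F p = aeval x p := fun p => rfl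
  have hinj : Function.Injective (algebraMap ℚ[X] F) :=
    transcendental_iff_injective.1 H.trans
  have : FaithfulSMul ℚ[X] F := (faithfulSMul_iff_algebraMap_injective _ _).2 hinj
  let : Algebra (FractionRing ℚ[X]) F := FractionRing.liftAlgebra ℚ[X] F
  have : IsScalarTower ℚ[X] (FractionRing ℚ[X]) F := FractionRing.isScalarTower_liftAlgebra _ _
  have hu : uu x y ^ 2 = algebraMap (FractionRing ℚ[X]) F
      (algebraMap ℚ[X] (FractionRing ℚ[X]) DD) := by
    rw [← IsScalarTower.algebraMap_apply, hmap, H.u_sq]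
  have hX : ∀ E : IntermediateField (FractionRing ℚ[X]) F, x ∈ E := fun E => by
    have := E.algebraMap_mem (algebraMap ℚ[X] (FractionRing ℚ[X]) X)
    rwa [← IsScalarTower.algebraMap_apply, hmap, aeval_X] at this
  have htop : IntermediateField.adjoin (FractionRing ℚ[X]) {uu x y} = ⊤ := by
    set E := IntermediateField.adjoin (FractionRing ℚ[X]) {uu x y} with hE
    have hy : y ∈ E := by
      have h1 : uu x y ∈ E := IntermediateField.subset_adjoin _ _ (by simp)
      have hx := hX E
      have hn : ∀ n : ℕ, (n : F) ∈ E := fun n => natCast_mem E n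
      have e : y = (uu x y - ((2 : ℕ) * x ^ 3 - (3 : ℕ) * x ^ 2 - (41 : ℕ) * x + (110 : ℕ)))
          / (2 : ℕ) := by
        have := H.cz
        unfold uu
        push_cast
        ring
      rw [e]
      exact div_mem (sub_mem h1 (add_mem (sub_mem (sub_mem (mul_mem (hn _) (pow_mem hx _))
        (mul_mem (hn _) (pow_mem hx _))) (mul_mem (hn _) hx)) (hn _))) (hn _)
    have hle : IntermediateField.adjoin ℚ ({x, y} : Set F) ≤
        E.toSubfield.toIntermediateField (fun a => by
          rw [eq_ratCast]; exact SubfieldClass.ratCast_mem E.toSubfield a) := by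
      rw [IntermediateField.adjoin_le_iff]
      rintro z (rfl | hz)
      · exact hX E
      · rw [Set.mem_singleton_iff.1 hz]; exact hy
    rw [H.gen] at hle
    rw [eq_top_iff]
    intro z _
    exact hle (show z ∈ (⊤ : IntermediateField ℚ F) from trivial)
  obtain ⟨T, B, hTB⟩ := quad_span hu htop g
  have hIntg : IsIntegral ℚ[X] g := by
    by_contra hni
    have hn : g ∉ (integralClosure ℚ[X] F).toSubring := hni
    have : IsIntegrallyClosedIn (integralClosure ℚ[X] F).toSubring F :=
      inferInstanceAs (IsIntegrallyClosedIn (integralClosure ℚ[X] F) F)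
    obtain ⟨V, hV, hgV⟩ := Subring.exists_le_valuationSubring_of_isIntegrallyClosedIn hn
    have hV' : ∀ p : ℚ[X], aeval x p ∈ V := fun p =>
      hV (show IsIntegral ℚ[X] (aeval x p) from isIntegral_algebraMap (A := F) (x := p))
    refine hgV (hg V (fun a => ?_) (by simpa using hV' X))
    simpa using hV' (C a)
  have h2 : IsUnit (2 : ℚ[X]) := by
    have : (2 : ℚ[X]) = C (2 : ℚ) := (map_ofNat C _).symm
    rw [this]
    exact (isUnit_iff_ne_zero.2 two_ne_zero).map C
  have hu' : uu x y ^ 2 = algebraMap ℚ[X] F DD := H.u_sq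
  exact int_repr h2 DD_sqf DD_ne hu' T B hTB hIntg

end repr

section infinity

open Polynomial

variable {F : Type*} [Field F] [Algebra ℚ F] {v w : ValuationSubring F} {o o' : F → ℤ} {x y : F}

theorem res_aeval (h : OrdAt v o) {z : F} {c : ℚ} (hz : Res v z c) (P : ℚ[X]) :
    Res v (aeval z P) (P.eval c) := by
  induction P using Polynomial.induction_on' with
  | add p q hp hq => rw [map_add, eval_add]; exact hp.add hq
  | monomial n a =>
    rw [aeval_monomial, eval_monomial, eq_ratCast]
    exact (Res.const a).mul h (hz.pow h n)

theorem aeval_reflect (hx0 : x ≠ 0) (A : ℚ[X]) (M : ℕ) (hM : A.natDegree ≤ M) :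
    aeval x A / x ^ M = aeval x⁻¹ (A.reflect M) := by
  let := invertibleOfNonzero hx0
  have := eval₂_reflect_mul_pow (algebraMap ℚ F) x M A hM
  rw [invOf_eq_inv] at this
  rw [div_eq_iff (pow_ne_zero _ hx0)]
  exact this.symm

theorem res_poly_inf (h : OrdAt v o) (hx0 : x ≠ 0) (hx : Res v x⁻¹ 0) (A : ℚ[X]) (M : ℕ)
    (hM : A.natDegree ≤ M) : Res v (aeval x A / x ^ M) (A.coeff M) := by
  rw [aeval_reflect hx0 A M hM]
  refine (res_aeval h hx _).congr rfl ?_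
  rw [← coeff_zero_eq_eval_zero, coeff_reflect]
  simp

theorem res_u_inf (h : OrdAt v o) (hx0 : x ≠ 0) (hx : Res v x⁻¹ 0) {b : ℚ}
    (hy : Res v (y / x ^ 3) b) : Res v (uu x y / x ^ 3) (2 * b + 2) := by
  refine (res_pf h hx hy 2 (-3) (-41) 110 0 0 2 0).congr ?_ ?_
  · unfold pf uu
    push_cast
    field_simp
    ring
  · unfold pq
    ring

theorem L_inf (h : OrdAt v o) (hx0 : x ≠ 0) (hx : Res v x⁻¹ 0) {b : ℚ}
    (hy : Res v (y / x ^ 3) b) (A B : ℚ[X]) (M : ℕ) (hA : A.natDegree ≤ M + 3)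
    (hB : B.natDegree ≤ M)
    (hg : v.valuation ((aeval x A + aeval x B * uu x y) / x ^ 2) ≤ 1) :
    A.coeff (M + 3) + B.coeff M * (2 * b + 2) = 0 := by
  have h1 := (res_poly_inf h hx0 hx A (M + 3) hA).add
    ((res_poly_inf h hx0 hx B M hB).mul h (res_u_inf h hx0 hx hy))
  refine h1.uniq h (c := A.coeff (M + 3) + B.coeff M * (2 * b + 2)) ?_
  have e : aeval x A / x ^ (M + 3) + aeval x B / x ^ M * (uu x y / x ^ 3) =
      (aeval x A + aeval x B * uu x y) / x ^ 2 * x⁻¹ ^ (M + 1) := by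
    rw [inv_pow, pow_add, pow_add, pow_one]
    field_simp
  unfold Res
  rw [e, Rat.cast_zero, sub_zero]
  refine mul_lt_of_le hg ?_
  rw [map_pow]
  exact pow_lt_one₀ zero_le hx.lt (by omega)

theorem L_poly (H : Curve F x y) (h : OrdAt v o) (h' : OrdAt w o')
    (hx : Res v x⁻¹ 0) (hy : Res v (y / x ^ 3) (-2)) (hx' : Res w x⁻¹ 0)
    (hy' : Res w (y / x ^ 3) 0) {g : F}
    (hg : ∀ v : ValuationSubring F, (∀ a : ℚ, (a : F) ∈ v) → x ∈ v → g ∈ v)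
    (h1 : v.valuation (g / x ^ 2) ≤ 1) (h2 : w.valuation (g / x ^ 2) ≤ 1) :
    ∃ A : ℚ[X], A.natDegree ≤ 2 ∧ g = aeval x A := by
  obtain ⟨A, B, rfl⟩ := H.repr hg
  have key : ∀ M : ℕ, A.natDegree ≤ M + 3 → B.natDegree ≤ M →
      A.coeff (M + 3) = 0 ∧ B.coeff M = 0 := by
    intro M hA hB
    have e1 := L_inf h H.x_ne hx hy A B M hA hB h1
    have e2 := L_inf h' H.x_ne hx' hy' A B M hA hB h2
    constructor <;> linarith
  have hB : B = 0 := by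
    by_contra hB
    rcases le_total A.natDegree (B.natDegree + 3) with hl | hl
    · exact hB (leadingCoeff_eq_zero.1 (key _ hl le_rfl).2)
    · obtain ⟨M, hM⟩ := Nat.exists_eq_add_of_le hl
      have := (key (B.natDegree + M) (by omega) (by omega)).1
      rw [show B.natDegree + M + 3 = A.natDegree by omega] at this
      have hA : A = 0 := leadingCoeff_eq_zero.1 this
      rw [hA, natDegree_zero] at hl
      omega
  refine ⟨A, ?_, by rw [hB]; simp⟩
  by_contra hA
  obtain ⟨M, hM⟩ := Nat.exists_eq_add_of_le (show 3 ≤ A.natDegree by omega)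
  have := (key M (by omega) (by rw [hB]; simp)).1
  rw [show M + 3 = A.natDegree by omega] at this
  have hA' : A = 0 := leadingCoeff_eq_zero.1 this
  rw [hA', natDegree_zero] at hM
  omega

/-- The order of a polynomial in `x` at infinity. -/
theorem ord_poly_inf (h : OrdAt v o) (hx0 : x ≠ 0) (hx : Res v x⁻¹ 0) (ho : o x = -1)
    {A : ℚ[X]} (hA : A ≠ 0) : aeval x A ≠ 0 ∧ o (aeval x A) = - A.natDegree := by
  have r := res_poly_inf h hx0 hx A A.natDegree le_rfl
  have hl : A.coeff A.natDegree ≠ 0 := leadingCoeff_ne_zero.2 hA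
  have hne : aeval x A ≠ 0 := by
    intro h0
    have := r.ne h hl
    rw [h0, zero_div] at this
    exact this rfl
  refine ⟨hne, ?_⟩
  have := r.ord h hl
  rw [div_eq_mul_inv, h.mul _ _ hne (inv_ne_zero (pow_ne_zero _ hx0)),
    h.inv (pow_ne_zero _ hx0), h.pow hx0, ho] at this
  linarith

/-- The order of a polynomial in `x` at a point where `x - c` is a uniformizer. -/
theorem ord_poly_le (h : OrdAt v o) {c : ℚ} (hx0 : x - c ≠ 0) (hx : Res v x c)
    (ho : o (x - c) = 1) {A : ℚ[X]} (hA : A ≠ 0) : o (aeval x A) ≤ A.natDegree := by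
  obtain ⟨B, hB, hr⟩ := exists_eq_pow_rootMultiplicity_mul_and_not_dvd A hA c
  have hBc : B.eval c ≠ 0 := fun h0 => hr (dvd_iff_isRoot.2 h0)
  have r := res_aeval h hx B
  have hxe : aeval x (X - C c) = x - (c : F) := by simp
  have h1 : o (aeval x A) = A.rootMultiplicity c := by
    conv_lhs => rw [hB]
    rw [map_mul, map_pow, hxe, h.mul _ _ (pow_ne_zero _ hx0) (r.ne h hBc), h.pow hx0, ho,
      r.ord h hBc]
    ring
  rw [h1]
  have : A.rootMultiplicity c ≤ A.natDegree := by
    refine (count_roots A (a := c)) ▸ ?_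
    exact (Multiset.count_le_card _ _).trans (card_roots' A)
  exact_mod_cast this

end infinity

section main

open Polynomial

variable {F : Type*} [Field F] [Algebra ℚ F] {x y : F}

/-- Monomials in the six functions. -/
def mm (x y : F) (a1 a2 a3 a4 a5 a6 : ℤ) : F :=
  (x - 2) ^ a1 * ((x - 4) ^ a2 * ((x + 4) ^ a3 * (f4 x y ^ a4 * (f5 x y ^ a5 * f6 x y ^ a6))))

theorem Curve.mm_ne (H : Curve F x y) (a1 a2 a3 a4 a5 a6 : ℤ) : mm x y a1 a2 a3 a4 a5 a6 ≠ 0 :=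
  mul_ne_zero (zpow_ne_zero _ H.n1) (mul_ne_zero (zpow_ne_zero _ H.n2)
    (mul_ne_zero (zpow_ne_zero _ H.n3) (mul_ne_zero (zpow_ne_zero _ H.ne4.1)
      (mul_ne_zero (zpow_ne_zero _ H.ne5.1) (zpow_ne_zero _ H.ne6.1)))))

theorem ord_mm (H : Curve F x y) {v : ValuationSubring F} {o : F → ℤ} (h : OrdAt v o)
    {b1 b2 b3 b4 b5 b6 : ℤ} (t : Tab o x y b1 b2 b3 b4 b5 b6) (a1 a2 a3 a4 a5 a6 : ℤ) :
    o (mm x y a1 a2 a3 a4 a5 a6) =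
      a1 * b1 + (a2 * b2 + (a3 * b3 + (a4 * b4 + (a5 * b5 + a6 * b6)))) := by
  have e1 := zpow_ne_zero a1 H.n1
  have e2 := zpow_ne_zero a2 H.n2
  have e3 := zpow_ne_zero a3 H.n3
  have e4 := zpow_ne_zero a4 H.ne4.1
  have e5 := zpow_ne_zero a5 H.ne5.1
  have e6 := zpow_ne_zero a6 H.ne6.1
  obtain ⟨t1, t2, t3, t4, t5, t6⟩ := t
  unfold mm
  rw [h.mul _ _ e1 (by simp only [mul_ne_zero_iff]; tauto),
    h.mul _ _ e2 (by simp only [mul_ne_zero_iff]; tauto),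
    h.mul _ _ e3 (by simp only [mul_ne_zero_iff]; tauto),
    h.mul _ _ e4 (by simp only [mul_ne_zero_iff]; tauto), h.mul _ _ e5 e6,
    h.zpow H.n1, h.zpow H.n2, h.zpow H.n3, h.zpow H.ne4.1, h.zpow H.ne5.1, h.zpow H.ne6.1,
    t1, t2, t3, t4, t5, t6]

/-- The type of places. -/
abbrev Pl (F : Type*) [Field F] [Algebra ℚ F] := {v : ValuationSubring F // IsCurvePlace v}

theorem Tab.eqs {o : F → ℤ} {a1 a2 a3 a4 a5 a6 b1 b2 b3 b4 b5 b6 : ℤ}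
    (s : Tab o x y a1 a2 a3 a4 a5 a6) (t : Tab o x y b1 b2 b3 b4 b5 b6) :
    a1 = b1 ∧ a2 = b2 ∧ a3 = b3 ∧ a4 = b4 ∧ a5 = b5 ∧ a6 = b6 := by
  obtain ⟨t1, t2, t3, t4, t5, t6⟩ := t
  obtain ⟨s1, s2, s3, s4, s5, s6⟩ := s
  exact ⟨s1 ▸ t1, s2 ▸ t2, s3 ▸ t3, s4 ▸ t4, s5 ▸ t5, s6 ▸ t6⟩

/-- The situation of the main theorem. -/
structure Sit (x y : F) (ord : Pl F → F → ℤ) (Q₁ Q₂ Pa Pb : Pl F) : Prop where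
  H : Curve F x y
  h : ∀ v, OrdAt v.1 (ord v)
  a1 : Res Pa.1 x⁻¹ 0
  a2 : Res Pa.1 (y / x ^ 3) (-2)
  b1 : Res Pb.1 x⁻¹ 0
  b2 : Res Pb.1 (y / x ^ 3) 0
  q1 : Res Q₁.1 x 2
  q2 : Res Q₁.1 y 17
  r1 : Res Q₂.1 x 4
  r2 : Res Q₂.1 y 23

/-- The divisor. -/
noncomputable def Dv (Q₁ Q₂ Pa Pb : Pl F) : Pl F → ℤ := fun v =>
  (if v = Q₁ then 1 else 0) + (if v = Q₂ then 1 else 0)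
          - (if v = Pa then 1 else 0) - (if v = Pb then 1 else 0)

variable {ord : Pl F → F → ℤ} {Q₁ Q₂ Pa Pb : Pl F}

theorem Sit.places (S : Sit x y ord Q₁ Q₂ Pa Pb) (v : Pl F) :
    (v = Pa ∧ Dv Q₁ Q₂ Pa Pb v = -1 ∧ Tab (ord v) x y (-1) (-1) (-1) (-3) (-3) (-4)) ∨
    (v = Pb ∧ Dv Q₁ Q₂ Pa Pb v = -1 ∧ Tab (ord v) x y (-1) (-1) (-1) 0 (-1) (-4)) ∨
    (v = Q₁ ∧ Dv Q₁ Q₂ Pa Pb v = 1 ∧ Tab (ord v) x y 1 0 0 0 3 2) ∨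
    (Dv Q₁ Q₂ Pa Pb v = 0 ∧ Tab (ord v) x y 1 0 0 1 0 0) ∨
    (v = Q₂ ∧ Dv Q₁ Q₂ Pa Pb v = 1 ∧ Tab (ord v) x y 0 1 0 0 0 0) ∨
    (Dv Q₁ Q₂ Pa Pb v = 0 ∧ Tab (ord v) x y 0 1 0 1 0 6) ∨
    (Dv Q₁ Q₂ Pa Pb v = 0 ∧ Tab (ord v) x y 0 0 2 1 1 0) ∨
    (Dv Q₁ Q₂ Pa Pb v = 0 ∧ Tab (ord v) x y 0 0 0 0 0 0) := by
  obtain ⟨H, h, a1, a2, b1, b2, q1, q2, r1, r2⟩ := S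
  have ta := tab_Pa H (h Pa) a1 a2
  have tb := tab_Pb H (h Pb) b1 b2
  have tq := tab_Q1 H (h Q₁) q1 q2
  have tr := tab_Q2 H (h Q₂) r1 r2
  have nab : Pa ≠ Pb := by rintro rfl; have := ta.eqs tb; omega
  have naq : Pa ≠ Q₁ := by rintro rfl; have := ta.eqs tq; omega
  have nar : Pa ≠ Q₂ := by rintro rfl; have := ta.eqs tr; omega
  have nbq : Pb ≠ Q₁ := by rintro rfl; have := tb.eqs tq; omega
  have nbr : Pb ≠ Q₂ := by rintro rfl; have := tb.eqs tr; omega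
  have nqr : Q₁ ≠ Q₂ := by rintro rfl; have := tq.eqs tr; omega
  have z : ∀ c1 c2 c3 c4 c5 c6 : ℤ, Tab (ord v) x y c1 c2 c3 c4 c5 c6 →
      ¬ (c1 = -1) → ¬ (c1 = 1 ∧ c4 = 0) → ¬ (c2 = 1 ∧ c4 = 0) → Dv Q₁ Q₂ Pa Pb v = 0 := by
    intro c1 c2 c3 c4 c5 c6 t e1 e2 e3
    have n1 : v ≠ Pa := by rintro rfl; have := ta.eqs t; omega
    have n2 : v ≠ Pb := by rintro rfl; have := tb.eqs t; omega
    have n3 : v ≠ Q₁ := by rintro rfl; have := tq.eqs t; omega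
    have n4 : v ≠ Q₂ := by rintro rfl; have := tr.eqs t; omega
    simp [Dv, n1, n2, n3, n4]
  rcases classify H (h v) with ⟨hx, hy⟩ | ⟨hx, hy⟩ | ⟨hx, hy⟩ | ⟨hx, hy⟩ | ⟨hx, hy⟩ | ⟨hx, hy⟩ |
    ⟨hx, hy⟩ | ⟨hx, hy⟩
  · have : v = Pa := Subtype.ext (uniq_Pa H (h v) (h Pa) hx hy a1 a2).1
    subst this
    exact Or.inl ⟨rfl, by simp [Dv, nab, naq, nar], ta⟩
  · have : v = Pb := Subtype.ext (uniq_Pb H (h v) (h Pb) hx hy b1 b2).1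
    subst this
    exact Or.inr (Or.inl ⟨rfl, by simp [Dv, nab.symm, nbq, nbr], tb⟩)
  · have : v = Q₁ := Subtype.ext (uniq_Q1 H (h v) (h Q₁) hx hy q1 q2).1
    subst this
    exact Or.inr (Or.inr (Or.inl ⟨rfl, by simp [Dv, naq.symm, nbq.symm, nqr], tq⟩))
  · have t := tab_R1 H (h v) hx hy
    exact Or.inr (Or.inr (Or.inr (Or.inl ⟨z _ _ _ _ _ _ t (by norm_num) (by norm_num)
      (by norm_num), t⟩)))
  · have : v = Q₂ := Subtype.ext (uniq_Q2 H (h v) (h Q₂) hx hy r1 r2).1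
    subst this
    exact Or.inr (Or.inr (Or.inr (Or.inr (Or.inl
      ⟨rfl, by simp [Dv, nar.symm, nbr.symm, nqr.symm], tr⟩))))
  · have t := tab_R2 H (h v) hx hy
    exact Or.inr (Or.inr (Or.inr (Or.inr (Or.inr (Or.inl
      ⟨z _ _ _ _ _ _ t (by norm_num) (by norm_num) (by norm_num), t⟩)))))
  · have t := tab_W H (h v) hx hy
    exact Or.inr (Or.inr (Or.inr (Or.inr (Or.inr (Or.inr (Or.inl
      ⟨z _ _ _ _ _ _ t (by norm_num) (by norm_num) (by norm_num), t⟩))))))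
  · exact Or.inr (Or.inr (Or.inr (Or.inr (Or.inr (Or.inr (Or.inr
      ⟨z _ _ _ _ _ _ hy (by norm_num) (by norm_num) (by norm_num), hy⟩))))))

/-- `70 D` is principal. -/
theorem Sit.seventy (S : Sit x y ord Q₁ Q₂ Pa Pb) (v : Pl F) :
    70 * Dv Q₁ Q₂ Pa Pb v = ord v (mm x y 16 70 (-4) (-16) 24 (-9)) := by
  rcases S.places v with ⟨_, d, t⟩ | ⟨_, d, t⟩ | ⟨_, d, t⟩ | ⟨d, t⟩ | ⟨_, d, t⟩ | ⟨d, t⟩ |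
    ⟨d, t⟩ | ⟨d, t⟩ <;> rw [d, ord_mm S.H (S.h v) t] <;> norm_num

/-- Nonzero functions with poles bounded by `2 Pa + 2 Pb` are polynomials in `x`. -/
theorem Sit.poly (S : Sit x y ord Q₁ Q₂ Pa Pb) {g : F} (hg0 : g ≠ 0)
    (hg : ∀ v : Pl F, v ≠ Pa → v ≠ Pb → 0 ≤ ord v g) (ha : -2 ≤ ord Pa g)
    (hb : -2 ≤ ord Pb g) :
    ord Pa g = ord Pb g ∧ ord Q₂ g ≤ 2 := by
  have oa := (uniq_Pa S.H (S.h Pa) (S.h Pa) S.a1 S.a2 S.a1 S.a2).2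
  have ob := (uniq_Pb S.H (S.h Pb) (S.h Pb) S.b1 S.b2 S.b1 S.b2).2
  have o2 := (uniq_Q2 S.H (S.h Q₂) (S.h Q₂) S.r1 S.r2 S.r1 S.r2).2
  have x0 := S.H.x_ne
  have g2 : g / x ^ 2 ≠ 0 := div_ne_zero hg0 (pow_ne_zero _ x0)
  have hv : ∀ v : Pl F, ord v x = -1 → -2 ≤ ord v g → v.1.valuation (g / x ^ 2) ≤ 1 := by
    intro v h1 h2
    rw [← (S.h v).nonneg_iff g2, div_eq_mul_inv,
      (S.h v).mul _ _ hg0 (inv_ne_zero (pow_ne_zero _ x0)), (S.h v).inv (pow_ne_zero _ x0),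
      (S.h v).pow x0, h1]
    push_cast
    linarith
  obtain ⟨A, hA2, rfl⟩ := L_poly S.H (S.h Pa) (S.h Pb) S.a1 S.a2 S.b1 S.b2 (g := g)
    (by
      intro v hr hxv
      by_cases hT : v = ⊤
      · rw [hT]; trivial
      · have hp : IsCurvePlace v := ⟨hT, fun a => by rw [eq_ratCast]; exact hr a⟩
        refine ((S.h ⟨v, hp⟩).ring g hg0).1 (hg ⟨v, hp⟩ ?_ ?_)
        · intro e
          have := ((S.h ⟨v, hp⟩).ring x x0).2 hxv
          rw [e, oa] at this
          omega
        · intro e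
          have := ((S.h ⟨v, hp⟩).ring x x0).2 hxv
          rw [e, ob] at this
          omega) (hv Pa oa ha) (hv Pb ob hb)
  have hA : A ≠ 0 := by
    rintro rfl
    exact hg0 (map_zero _)
  refine ⟨?_, ?_⟩
  · rw [(ord_poly_inf (S.h Pa) x0 S.a1 oa hA).2, (ord_poly_inf (S.h Pb) x0 S.b1 ob hA).2]
  · have := ord_poly_le (c := 4) (S.h Q₂) (S.H.sub_ne 4) S.r1 (by simpa using o2) hA
    refine this.trans ?_
    exact_mod_cast hA2

theorem Sit.ord_prod (S : Sit x y ord Q₁ Q₂ Pa Pb) {g : F} (hg0 : g ≠ 0) {n : ℤ}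
    (hg : ∀ v, n * Dv Q₁ Q₂ Pa Pb v = ord v g) (j : ℕ) (a1 a2 a3 a4 a5 a6 : ℤ) (v : Pl F) :
    ord v (g ^ j * mm x y a1 a2 a3 a4 a5 a6) =
      j * (n * Dv Q₁ Q₂ Pa Pb v) + ord v (mm x y a1 a2 a3 a4 a5 a6) := by
  rw [(S.h v).mul _ _ (pow_ne_zero _ hg0) (S.H.mm_ne _ _ _ _ _ _), (S.h v).pow hg0, hg]

theorem Sit.vals (S : Sit x y ord Q₁ Q₂ Pa Pb) (a1 a2 a3 a4 a5 a6 : ℤ) :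
    (Dv Q₁ Q₂ Pa Pb Pa = -1 ∧ ord Pa (mm x y a1 a2 a3 a4 a5 a6) =
      - a1 - a2 - a3 - 3 * a4 - 3 * a5 - 4 * a6) ∧
    (Dv Q₁ Q₂ Pa Pb Pb = -1 ∧ ord Pb (mm x y a1 a2 a3 a4 a5 a6) =
      - a1 - a2 - a3 - a5 - 4 * a6) ∧
    (Dv Q₁ Q₂ Pa Pb Q₂ = 1 ∧ ord Q₂ (mm x y a1 a2 a3 a4 a5 a6) = a2) := by
  have ta := tab_Pa S.H (S.h Pa) S.a1 S.a2
  have tb := tab_Pb S.H (S.h Pb) S.b1 S.b2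
  have tr := tab_Q2 S.H (S.h Q₂) S.r1 S.r2
  refine ⟨⟨?_, ?_⟩, ⟨?_, ?_⟩, ?_, ?_⟩
  · rcases S.places Pa with ⟨_, d, t⟩ | ⟨_, d, t⟩ | ⟨_, d, t⟩ | ⟨d, t⟩ | ⟨_, d, t⟩ | ⟨d, t⟩ |
      ⟨d, t⟩ | ⟨d, t⟩ <;> have := ta.eqs t <;> omega
  · rw [ord_mm S.H (S.h Pa) ta]; ring
  · rcases S.places Pb with ⟨_, d, t⟩ | ⟨_, d, t⟩ | ⟨_, d, t⟩ | ⟨d, t⟩ | ⟨_, d, t⟩ | ⟨d, t⟩ |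
      ⟨d, t⟩ | ⟨d, t⟩ <;> have := tb.eqs t <;> omega
  · rw [ord_mm S.H (S.h Pb) tb]; ring
  · rcases S.places Q₂ with ⟨_, d, t⟩ | ⟨_, d, t⟩ | ⟨_, d, t⟩ | ⟨d, t⟩ | ⟨_, d, t⟩ | ⟨d, t⟩ |
      ⟨d, t⟩ | ⟨d, t⟩ <;> have := tr.eqs t <;> omega
  · rw [ord_mm S.H (S.h Q₂) tr]; ring

/-- A common consequence: the function `g ^ j * mm` satisfies the constraints. -/
theorem Sit.concl (S : Sit x y ord Q₁ Q₂ Pa Pb) {g : F} (hg0 : g ≠ 0) {n : ℤ}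
    (hg : ∀ v, n * Dv Q₁ Q₂ Pa Pb v = ord v g) (j : ℕ) (a1 a2 a3 a4 a5 a6 : ℤ)
    (c1 : -2 ≤ -(j * n) - a1 - a2 - a3 - 3 * a4 - 3 * a5 - 4 * a6)
    (c2 : -2 ≤ -(j * n) - a1 - a2 - a3 - a5 - 4 * a6)
    (c3 : 0 ≤ j * n + a1 + 3 * a5 + 2 * a6) (c4 : 0 ≤ a1 + a4) (c5 : 0 ≤ j * n + a2)
    (c6 : 0 ≤ a2 + a4 + 6 * a6) (c7 : 0 ≤ 2 * a3 + a4 + a5) :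
    3 * a4 + 2 * a5 = 0 ∧ j * n + a2 ≤ 2 := by
  obtain ⟨⟨d1, e1⟩, ⟨d2, e2⟩, d3, e3⟩ := S.vals a1 a2 a3 a4 a5 a6
  have p := S.ord_prod hg0 hg j a1 a2 a3 a4 a5 a6
  have p1 := p Pa
  have p2 := p Pb
  have p3 := p Q₂
  rw [d1, e1] at p1
  rw [d2, e2] at p2
  rw [d3, e3] at p3
  have := S.poly (mul_ne_zero (pow_ne_zero j hg0) (S.H.mm_ne a1 a2 a3 a4 a5 a6)) (by
    intro v na nb
    rw [p v]
    rcases S.places v with ⟨e, d, t⟩ | ⟨e, d, t⟩ | ⟨_, d, t⟩ | ⟨d, t⟩ | ⟨_, d, t⟩ | ⟨d, t⟩ |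
      ⟨d, t⟩ | ⟨d, t⟩
    · exact absurd e na
    · exact absurd e nb
    all_goals rw [d, ord_mm S.H (S.h v) t]; linarith) (by linarith) (by linarith)
  rw [p1, p2, p3] at this
  constructor <;> linarith [this.1, this.2]

theorem Sit.not35 (S : Sit x y ord Q₁ Q₂ Pa Pb) {g : F} (hg0 : g ≠ 0)
    (hg : ∀ v, (35 : ℤ) * Dv Q₁ Q₂ Pa Pb v = ord v g) : False := by
  have := S.concl hg0 hg 1 (-7) (-32) 2 8 (-12) 4 (by norm_num) (by norm_num) (by norm_num)
    (by norm_num) (by norm_num) (by norm_num) (by norm_num)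
  norm_num at this

theorem Sit.not14 (S : Sit x y ord Q₁ Q₂ Pa Pb) {g : F} (hg0 : g ≠ 0)
    (hg : ∀ v, (14 : ℤ) * Dv Q₁ Q₂ Pa Pb v = ord v g) : False := by
  have := S.concl hg0 hg 1 (-3) (-14) 1 3 (-5) 2 (by norm_num) (by norm_num) (by norm_num)
    (by norm_num) (by norm_num) (by norm_num) (by norm_num)
  norm_num at this

theorem Sit.not10 (S : Sit x y ord Q₁ Q₂ Pa Pb) {g : F} (hg0 : g ≠ 0)
    (hg : ∀ v, (10 : ℤ) * Dv Q₁ Q₂ Pa Pb v = ord v g) : False := by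
  have := S.concl hg0 hg 4 (-8) (-39) 3 9 (-14) 5 (by norm_num) (by norm_num) (by norm_num)
    (by norm_num) (by norm_num) (by norm_num) (by norm_num)
  norm_num at this

/-- The group generated by principal divisors consists of principal divisors. -/
theorem Sit.principal (S : Sit x y ord Q₁ Q₂ Pa Pb) (d : Pl F → ℤ) :
    d ∈ AddSubgroup.closure {d : Pl F → ℤ | ∃ f : F, f ≠ 0 ∧ d = fun v => ord v f} ↔
      ∃ f : F, f ≠ 0 ∧ d = fun v => ord v f := by
  refine ⟨fun hd => ?_, fun hd => AddSubgroup.subset_closure hd⟩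
  induction hd using AddSubgroup.closure_induction with
  | mem z hz => exact hz
  | zero => exact ⟨1, one_ne_zero, by funext v; simp [(S.h v).one]⟩
  | add a b _ _ ha hb =>
    obtain ⟨f, f0, rfl⟩ := ha
    obtain ⟨g, g0, rfl⟩ := hb
    exact ⟨f * g, mul_ne_zero f0 g0, by funext v; simp [(S.h v).mul f g f0 g0]⟩
  | neg a _ ha =>
    obtain ⟨f, f0, rfl⟩ := ha
    exact ⟨f⁻¹, inv_ne_zero f0, by funext v; simp [(S.h v).inv f0]⟩

theorem Sit.smul_iff (S : Sit x y ord Q₁ Q₂ Pa Pb) (n : ℕ) :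
    n • (QuotientAddGroup.mk' (AddSubgroup.closure
      {d : Pl F → ℤ | ∃ f : F, f ≠ 0 ∧ d = fun v => ord v f}) (Dv Q₁ Q₂ Pa Pb)) = 0 ↔
      ∃ f : F, f ≠ 0 ∧ ∀ v, (n : ℤ) * Dv Q₁ Q₂ Pa Pb v = ord v f := by
  rw [← map_nsmul, QuotientAddGroup.mk'_apply, QuotientAddGroup.eq_zero_iff, S.principal]
  refine exists_congr fun f => and_congr_right fun _ => ?_
  rw [funext_iff]
  refine forall_congr' fun v => ?_
  rw [Pi.smul_apply, nsmul_eq_mul]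

theorem Sit.order (S : Sit x y ord Q₁ Q₂ Pa Pb) :
    addOrderOf (QuotientAddGroup.mk' (AddSubgroup.closure
      {d : Pl F → ℤ | ∃ f : F, f ≠ 0 ∧ d = fun v => ord v f}) (Dv Q₁ Q₂ Pa Pb)) = 70 := by
  refine addOrderOf_eq_of_nsmul_and_div_prime_nsmul (by norm_num) ?_ ?_
  · rw [S.smul_iff]
    exact ⟨_, S.H.mm_ne _ _ _ _ _ _, S.seventy⟩
  · intro p hp hd
    rw [Ne, S.smul_iff]
    rintro ⟨g, g0, hg⟩
    have : p = 2 ∨ p = 5 ∨ p = 7 := by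
      rw [show 70 = 2 * (5 * 7) by norm_num, hp.dvd_mul, hp.dvd_mul] at hd
      rcases hd with hd | hd | hd
      · exact Or.inl ((Nat.prime_dvd_prime_iff_eq hp Nat.prime_two).1 hd)
      · exact Or.inr (Or.inl ((Nat.prime_dvd_prime_iff_eq hp Nat.prime_five).1 hd))
      · exact Or.inr (Or.inr ((Nat.prime_dvd_prime_iff_eq hp (by norm_num)).1 hd))
    rcases this with rfl | rfl | rfl
    · exact S.not35 g0 (by simpa using hg)
    · exact S.not14 g0 (by simpa using hg)
    · exact S.not10 g0 (by simpa using hg)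

end main

end C70

/-- The divisor class of `(2,17) + (4,23) − P₁ − P₂`, where `P₁`, `P₂` are the two points
at infinity, is a torsion point of order exactly `70` on the Jacobian of the genus-2 curve
`C₇₀ : y² + (2x³ − 3x² − 41x + 110)y = x³ − 51x² + 425x + 179` over `ℚ`.

Formalization: `F` is the function field of `C₇₀`, presented as a field generated over
`ℚ` by elements `x`, `y` satisfying the curve equation, with `x` transcendental.  Its
places (closed points of the smooth projective model) are the nontrivial valuation
subrings of `F` containing `ℚ`, and `ord v` is the normalized (surjective, `ℤ`-valued)
valuation at the place `v`.  The divisor group is the group of `ℤ`-valued functions on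
places, principal divisors are those of the form `v ↦ ord v f` for `f ∈ F*`, and the
divisor class group (into which the Jacobian `Jac(C₇₀)(ℚ)` of degree-zero classes
injects, making the order statement equivalent) is the quotient.  `P₁`, `P₂` are the two
poles of `x` (the points at infinity) and `Q₁`, `Q₂` are the places corresponding to the
rational points `(2,17)` and `(4,23)`.  The class of the divisor `Q₁ + Q₂ − P₁ − P₂` has
order exactly `70`. -/
theorem order_seventy_on_jacobian_C70
    (F : Type*) [Field F] [Algebra ℚ F] (x y : F)
    (hcurve : y ^ 2 + (2 * x ^ 3 - 3 * x ^ 2 - 41 * x + 110) * y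
      = x ^ 3 - 51 * x ^ 2 + 425 * x + 179)
    (htrans : Transcendental ℚ x)
    (hgen : IntermediateField.adjoin ℚ ({x, y} : Set F) = ⊤)
    (ord : {v : ValuationSubring F // IsCurvePlace v} → F → ℤ)
    (hord_mul : ∀ v (f g : F), f ≠ 0 → g ≠ 0 → ord v (f * g) = ord v f + ord v g)
    (hord_unif : ∀ v, ∃ f : F, f ≠ 0 ∧ ord v f = 1)
    (hord_ring : ∀ v (f : F), f ≠ 0 → (0 ≤ ord v f ↔ f ∈ v.1))
    (P₁ P₂ Q₁ Q₂ : {v : ValuationSubring F // IsCurvePlace v})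
    (hP : P₁ ≠ P₂) (hP₁ : ord P₁ x < 0) (hP₂ : ord P₂ x < 0)
    (hQ₁x : 0 < ord Q₁ (x - 2)) (hQ₁y : 0 < ord Q₁ (y - 17))
    (hQ₂x : 0 < ord Q₂ (x - 4)) (hQ₂y : 0 < ord Q₂ (y - 23)) :
    addOrderOf
      (QuotientAddGroup.mk'
        (AddSubgroup.closure
          {d : {v : ValuationSubring F // IsCurvePlace v} → ℤ |
            ∃ f : F, f ≠ 0 ∧ d = fun v => ord v f})
        (fun v => (if v = Q₁ then 1 else 0) + (if v = Q₂ then 1 else 0)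
          - (if v = P₁ then 1 else 0) - (if v = P₂ then 1 else 0))) = 70 := by
  have H : C70.Curve F x y := ⟨hcurve, htrans, hgen⟩
  have h : ∀ v, C70.OrdAt v.1 (ord v) := fun v =>
    ⟨fun a => by simpa using v.2.2 a, hord_mul v, hord_unif v, hord_ring v⟩
  have hres : ∀ (v : {v : ValuationSubring F // IsCurvePlace v}) (f : F) (c : ℚ),
      0 < ord v (f - c) → C70.Res v.1 f c := by
    intro v f c hv
    unfold C70.Res
    by_cases h0 : f - (c : F) = 0
    · rw [h0, map_zero]
      exact zero_lt_one
    · exact ((h v).pos_iff h0).1 hv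
  have hinf : ∀ v, ord v x < 0 → C70.Res v.1 x⁻¹ 0 := by
    intro v hv
    apply hres
    rw [Rat.cast_zero, sub_zero, (h v).inv H.x_ne]
    omega
  have q1 := hres Q₁ x 2 (by simpa using hQ₁x)
  have q2 := hres Q₁ y 17 (by simpa using hQ₁y)
  have r1 := hres Q₂ x 4 (by simpa using hQ₂x)
  have r2 := hres Q₂ y 23 (by simpa using hQ₂y)
  have a1 := hinf P₁ hP₁
  have b1 := hinf P₂ hP₂
  rcases C70.inf_split H (h P₁) a1 with a2 | a2 <;> rcases C70.inf_split H (h P₂) b1 with b2 | b2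
  · exact absurd (Subtype.ext (C70.uniq_Pa H (h P₁) (h P₂) a1 a2 b1 b2).1) hP
  · exact C70.Sit.order (Pa := P₁) (Pb := P₂) ⟨H, h, a1, a2, b1, b2, q1, q2, r1, r2⟩
  · have := C70.Sit.order (Pa := P₂) (Pb := P₁) ⟨H, h, b1, b2, a1, a2, q1, q2, r1, r2⟩
    have e : C70.Dv Q₁ Q₂ P₂ P₁ = C70.Dv Q₁ Q₂ P₁ P₂ := by
      funext v
      unfold C70.Dv
      ring
    rw [e] at this
    exact this
  · exact absurd (Subtype.ext (C70.uniq_Pb H (h P₁) (h P₂) a1 a2 b1 b2).1) hP
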